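/- arXiv:1211.5217 — 2 statements merged into one kernel-verified Lean document; each statement's English description precedes it below -/
import Mathlib

section
/- Let a, b > 0 with a − 2b > 0, η ∈ (0, √(a−b) − √(a/2)), and φ_η an admissible cutoff. Then there exists an increasing sequence {x_k}_{k≥0} ⊂ (0,1) such that x_k ∈ I_k for all k ∈ ℕ; that is, for every k, the solution (f_{x_k,η}, g_{x_k,η}) of the regularized system with initial data (0, x_k) converges to (0,0) as r → +∞ and g_{x_k,η} changes sign exactly k times on (0,∞). -/
open Real Set Filter Topology

noncomputable section

/-- The Hamiltonian energy `H(f,g) = ½ f²(1−g²) + (a/4) g⁴ − (b/2) g²`. -/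
def Ham (a b f g : ℝ) : ℝ := 1 / 2 * f ^ 2 * (1 - g ^ 2) + a / 4 * g ^ 4 - b / 2 * g ^ 2

/-- The set `𝒜` of admissible points. -/
def Aadm (a b : ℝ) : Set (ℝ × ℝ) :=
  {p | 2 * p.1 ^ 2 - a * p.2 ^ 2 - (a - 2 * b) ≤ 0 ∧ p.2 ^ 2 ≤ 1}

/-- `φ` is an admissible cutoff function `φ_η`. -/
def IsCutoff (a b η : ℝ) (φ : ℝ → ℝ → ℝ) : Prop :=
  (∀ f g, φ f g ∈ Icc (0 : ℝ) 1) ∧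
  ContDiffOn ℝ (⊤ : ℕ∞) (fun p : ℝ × ℝ => φ p.1 p.2)
    (Ioo (-Real.sqrt (a - b)) (Real.sqrt (a - b)) ×ˢ (univ : Set ℝ)) ∧
  (∀ f g, φ f g = φ |f| |g|) ∧
  (∀ f g, Real.sqrt (a - b) - η / 2 ≤ |f| → φ f g = 0) ∧
  (∀ f g, |f| ≤ Real.sqrt (a - b) - η → φ f g = 1)

/-- `(f, g)` is a `C¹` solution on `s` of the original Cauchy problem
`f' + (2/r) f = g(f² − a g² + b)`, `g' = f(1 − g²)`, `f(0) = 0`, `g(0) = x`. -/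
def IsSolOn (a b x : ℝ) (f g : ℝ → ℝ) (s : Set ℝ) : Prop :=
  f 0 = 0 ∧ g 0 = x ∧ ContinuousOn f s ∧ ContinuousOn g s ∧
  ∀ r ∈ s, 0 < r →
    HasDerivAt f (g r * ((f r) ^ 2 - a * (g r) ^ 2 + b) - 2 / r * f r) r ∧
    HasDerivAt g (f r * (1 - (g r) ^ 2)) r

/-- `(f, g)` is a `C¹` solution on `s` of the regularized Cauchy problem
`f' + (2 φ(f,g)/r) f = g(f² − a g² + b)`, `g' = f(1 − g²)`, `f(0) = 0`, `g(0) = x`. -/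
def IsRegSolOn (a b : ℝ) (φ : ℝ → ℝ → ℝ) (x : ℝ) (f g : ℝ → ℝ) (s : Set ℝ) : Prop :=
  f 0 = 0 ∧ g 0 = x ∧ ContinuousOn f s ∧ ContinuousOn g s ∧
  ∀ r ∈ s, 0 < r →
    HasDerivAt f (g r * ((f r) ^ 2 - a * (g r) ^ 2 + b) - 2 * φ (f r) (g r) / r * f r) r ∧
    HasDerivAt g (f r * (1 - (g r) ^ 2)) r

/-- `(f, g)` is a solution on `s` of the autonomous (Hamiltonian) system
`f' = g(f² − a g² + b)`, `g' = f(1 − g²)` with initial data `(fi, gi)`. -/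
def IsAutSolOn (a b fi gi : ℝ) (f g : ℝ → ℝ) (s : Set ℝ) : Prop :=
  f 0 = fi ∧ g 0 = gi ∧ ContinuousOn f s ∧ ContinuousOn g s ∧
  ∀ r ∈ s,
    HasDerivAt f (g r * ((f r) ^ 2 - a * (g r) ^ 2 + b)) r ∧
    HasDerivAt g (f r * (1 - (g r) ^ 2)) r

/-- `(f, g)` is a solution on `s` of the shifted regularized system
`f' + (2 φ(f,g)/(ρ+r)) f = g(f² − a g² + b)`, `g' = f(1 − g²)` with initial data `(fi, gi)`. -/
def IsShiftSolOn (a b : ℝ) (φ : ℝ → ℝ → ℝ) (ρ fi gi : ℝ) (f g : ℝ → ℝ) (s : Set ℝ) : Prop :=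
  f 0 = fi ∧ g 0 = gi ∧ ContinuousOn f s ∧ ContinuousOn g s ∧
  ∀ r ∈ s,
    HasDerivAt f (g r * ((f r) ^ 2 - a * (g r) ^ 2 + b) - 2 * φ (f r) (g r) / (ρ + r) * f r) r ∧
    HasDerivAt g (f r * (1 - (g r) ^ 2)) r

/-- The interval `[0, R)` with possibly infinite right endpoint. -/
def edom (R : EReal) : Set ℝ := {r : ℝ | 0 ≤ r ∧ (r : EReal) < R}

/-- `g` changes sign at `r₀` relative to the interval `s`. -/
def ChangesSignAt (g : ℝ → ℝ) (s : Set ℝ) (r₀ : ℝ) : Prop :=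
  g r₀ = 0 ∧ ∃ ε > 0, Icc (r₀ - ε) (r₀ + ε) ⊆ s ∧
    g (r₀ - ε) * g (r₀ + ε) < 0 ∧ ∀ r ∈ Ioo (0 : ℝ) ε, g (r₀ - r) * g (r₀ + r) ≤ 0

/-- `g` changes sign exactly `k` times on `s`. -/
def ChangesSignExactly (g : ℝ → ℝ) (s : Set ℝ) (k : ℕ) : Prop :=
  {r | ChangesSignAt g s r}.Finite ∧ {r | ChangesSignAt g s r}.ncard = k

/-- The set `A_k`, for the family of solutions `x ↦ (F x, G x)`. -/
def Aset (a b : ℝ) (F G : ℝ → ℝ → ℝ) (k : ℕ) : Set ℝ :=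
  {x | x ∈ Ioo (0 : ℝ) 1 ∧
    (∃ L, L < 0 ∧ Tendsto (fun r => Ham a b (F x r) (G x r)) atTop (nhds L)) ∧
    ChangesSignExactly (G x) (Ioi 0) k}

/-- The set `I_k`, for the family of solutions `x ↦ (F x, G x)`. -/
def Iset (a b : ℝ) (F G : ℝ → ℝ → ℝ) (k : ℕ) : Set ℝ :=
  {x | x ∈ Ioo (0 : ℝ) 1 ∧
    Tendsto (fun r => (F x r, G x r)) atTop (nhds ((0 : ℝ), (0 : ℝ))) ∧
    ChangesSignExactly (G x) (Ioi 0) k}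

theorem le_of_hasDerivAt_nonneg {u : ℝ → ℝ} {s t : ℝ} (hst : s ≤ t)
    (hc : ContinuousOn u (Icc s t))
    (hd : ∀ r ∈ Ioo s t, ∃ v, HasDerivAt u v r ∧ 0 ≤ v) : u s ≤ u t := by
  refine monotoneOn_of_deriv_nonneg (convex_Icc s t) hc ?_ ?_ (left_mem_Icc.2 hst)
    (right_mem_Icc.2 hst) hst
  · intro r hr
    rw [interior_Icc] at hr
    obtain ⟨v, hv, -⟩ := hd r hr
    exact hv.differentiableAt.differentiableWithinAt
  · intro r hr
    rw [interior_Icc] at hr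
    obtain ⟨v, hv, h0⟩ := hd r hr
    rwa [hv.deriv]

/-- Mean value inequality with an affine lower bound. -/
theorem mul_sub_le_of_hasDerivAt {u : ℝ → ℝ} {s t c : ℝ} (hst : s ≤ t)
    (hc : ContinuousOn u (Icc s t))
    (hd : ∀ r ∈ Ioo s t, ∃ v, HasDerivAt u v r ∧ c ≤ v) : c * (t - s) ≤ u t - u s := by
  have := le_of_hasDerivAt_nonneg (u := fun r => u r - c * r) hst (by fun_prop) (by
    intro r hr
    obtain ⟨v, hv, h0⟩ := hd r hr
    exact ⟨v - c * 1, hv.sub ((hasDerivAt_id r).const_mul c), by linarith⟩)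
  linarith

theorem le_exp_mul_of_hasDerivAt {u : ℝ → ℝ} {s t K : ℝ} (hst : s ≤ t)
    (hc : ContinuousOn u (Icc s t))
    (hd : ∀ r ∈ Ioo s t, ∃ v, HasDerivAt u v r ∧ v ≤ K * u r) :
    u t ≤ exp (K * (t - s)) * u s := by
  have := le_of_hasDerivAt_nonneg (u := fun r => -(exp (K * (t - r)) * u r)) hst
    (by fun_prop) (by
    intro r hr
    obtain ⟨v, hv, h0⟩ := hd r hr
    have h1 : HasDerivAt (fun r => exp (K * (t - r))) (exp (K * (t - r)) * (K * -1)) r :=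
      (((hasDerivAt_id r).const_sub t).const_mul K).exp
    refine ⟨_, (h1.mul hv).neg, ?_⟩
    have := exp_pos (K * (t - r))
    nlinarith)
  rw [sub_self, mul_zero, exp_zero, one_mul] at this
  linarith

theorem exp_mul_le_of_hasDerivAt {u : ℝ → ℝ} {s t K : ℝ} (hst : s ≤ t)
    (hc : ContinuousOn u (Icc s t))
    (hd : ∀ r ∈ Ioo s t, ∃ v, HasDerivAt u v r ∧ K * u r ≤ v) :
    exp (K * (t - s)) * u s ≤ u t := by
  have := le_exp_mul_of_hasDerivAt (u := fun r => - u r) (K := K) hst hc.neg (by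
    intro r hr
    obtain ⟨v, hv, h0⟩ := hd r hr
    exact ⟨-v, hv.neg, by linarith⟩)
  linarith

/-- A continuous function without zeros keeps its sign on an interval. -/
theorem pos_of_ne_zero_on_Icc {u : ℝ → ℝ} {s t : ℝ} (hc : ContinuousOn u (Icc s t))
    (hne : ∀ r ∈ Icc s t, u r ≠ 0) {p : ℝ} (hp : p ∈ Icc s t) (hup : 0 < u p) :
    ∀ r ∈ Icc s t, 0 < u r := by
  intro r hr
  by_contra hneg
  push Not at hneg
  obtain ⟨z, hz, hz0⟩ := isPreconnected_Icc.intermediate_value hr hp hc ⟨hneg, hup.le⟩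
  exact hne z hz hz0

/-- The first time at which a continuous function meets a closed set of values. -/
theorem exists_first_mem {u : ℝ → ℝ} {s t : ℝ} (hst : s ≤ t) (hc : ContinuousOn u (Icc s t))
    {C : Set ℝ} (hC : IsClosed C) (ht : u t ∈ C) :
    ∃ q ∈ Icc s t, u q ∈ C ∧ ∀ r ∈ Ico s q, u r ∉ C := by
  have hcl : IsClosed (Icc s t ∩ u ⁻¹' C) := hc.preimage_isClosed_of_isClosed isClosed_Icc hC
  have hcpt : IsCompact (Icc s t ∩ u ⁻¹' C) :=
    isCompact_Icc.of_isClosed_subset hcl inter_subset_left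
  obtain ⟨q, ⟨hq, hqC⟩, hmin⟩ := hcpt.exists_isLeast ⟨t, ⟨hst, le_rfl⟩, ht⟩
  refine ⟨q, hq, hqC, fun r hr hrC => ?_⟩
  exact absurd (hmin ⟨⟨hr.1, hr.2.le.trans hq.2⟩, hrC⟩) (not_le.2 hr.2)

/-- The last time at which a continuous function meets a closed set of values. -/
theorem exists_last_mem {u : ℝ → ℝ} {s t : ℝ} (hst : s ≤ t) (hc : ContinuousOn u (Icc s t))
    {C : Set ℝ} (hC : IsClosed C) (hs : u s ∈ C) :
    ∃ q ∈ Icc s t, u q ∈ C ∧ ∀ r ∈ Ioc q t, u r ∉ C := by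
  have hcl : IsClosed (Icc s t ∩ u ⁻¹' C) := hc.preimage_isClosed_of_isClosed isClosed_Icc hC
  have hcpt : IsCompact (Icc s t ∩ u ⁻¹' C) :=
    isCompact_Icc.of_isClosed_subset hcl inter_subset_left
  obtain ⟨q, ⟨hq, hqC⟩, hmax⟩ := hcpt.exists_isGreatest ⟨s, ⟨le_rfl, hst⟩, hs⟩
  refine ⟨q, hq, hqC, fun r hr hrC => ?_⟩
  exact absurd (hmax ⟨⟨hq.1.trans hr.1.le, hr.2⟩, hrC⟩) (not_le.2 hr.1)

/-- A continuous function going from above `β` to below `α` crosses `[α, β]` downwards. -/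
theorem exists_downcrossing {u : ℝ → ℝ} {s t α β : ℝ} (hst : s ≤ t)
    (hc : ContinuousOn u (Icc s t)) (hs : β ≤ u s) (ht : u t ≤ α) :
    ∃ p q, s ≤ p ∧ p ≤ q ∧ q ≤ t ∧ β ≤ u p ∧ u q ≤ α ∧ ∀ r ∈ Ioo p q, α < u r ∧ u r < β := by
  obtain ⟨q, hq, hqC, hqmin⟩ := exists_first_mem hst hc (isClosed_Iic (a := α)) ht
  obtain ⟨p, hp, hpC, hpmax⟩ := exists_last_mem hq.1 (hc.mono (Icc_subset_Icc_right hq.2))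
    (isClosed_Ici (a := β)) hs
  refine ⟨p, q, hp.1, hp.2, hq.2, hpC, hqC, fun r hr => ⟨?_, ?_⟩⟩
  · exact not_le.1 (hqmin r ⟨hp.1.trans hr.1.le, hr.2⟩)
  · exact not_le.1 (hpmax r ⟨hr.1, hr.2.le⟩)

/-- The damped Hamiltonian system with damping coefficient `d`, confined strictly below the energy
level of the equilibria with `g = ±1`. -/
structure IsDampedOrbit (a b δ : ℝ) (f g d : ℝ → ℝ) : Prop where
  hb : 0 < b
  hab : 2 * b < a
  hδ : 0 < δ
  contf : ContinuousOn f (Ici 0)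
  contg : ContinuousOn g (Ici 0)
  derivf : ∀ r, 0 < r →
    HasDerivAt f (g r * (f r ^ 2 - a * g r ^ 2 + b) - 2 * d r / r * f r) r
  derivg : ∀ r, 0 < r → HasDerivAt g (f r * (1 - g r ^ 2)) r
  damp_mem : ∀ r, d r ∈ Icc (0 : ℝ) 1
  damp_one : ∀ r, 0 ≤ r → a * g r ^ 2 ≤ 2 * b → d r = 1
  g_lt : ∀ r, 0 ≤ r → g r ^ 2 < 1
  gap : ∀ r, 0 ≤ r → 4 * δ ≤ (1 - g r ^ 2) * (a * g r ^ 2 + a - 2 * b - 2 * f r ^ 2)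
  ne_zero : ∀ r, 0 ≤ r → f r = 0 → g r ≠ 0

theorem ham_neg (a b f g : ℝ) : Ham a b (-f) (-g) = Ham a b f g := by
  unfold Ham; ring

theorem hasDerivAt_ham {a b : ℝ} {f g : ℝ → ℝ} {r c : ℝ}
    (hf : HasDerivAt f (g r * (f r ^ 2 - a * g r ^ 2 + b) - c * f r) r)
    (hg : HasDerivAt g (f r * (1 - g r ^ 2)) r) :
    HasDerivAt (fun r => Ham a b (f r) (g r)) (-c * f r ^ 2 * (1 - g r ^ 2)) r := by
  have h := (((hf.pow 2).const_mul (1 / 2)).mul ((hg.pow 2).const_sub 1)).add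
    ((hg.pow 4).const_mul (a / 4)) |>.sub ((hg.pow 2).const_mul (b / 2))
  refine h.congr_deriv ?_
  push_cast
  simp only [Pi.pow_apply]
  ring

theorem continuousOn_ham {a b : ℝ} {f g : ℝ → ℝ} {s : Set ℝ}
    (hf : ContinuousOn f s) (hg : ContinuousOn g s) :
    ContinuousOn (fun r => Ham a b (f r) (g r)) s := by
  unfold Ham
  fun_prop

namespace IsDampedOrbit

variable {a b δ : ℝ} {f g d : ℝ → ℝ}

theorem neg (h : IsDampedOrbit a b δ f g d) :
    IsDampedOrbit a b δ (fun r => -f r) (fun r => -g r) d where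
  hb := h.hb
  hab := h.hab
  hδ := h.hδ
  contf := h.contf.neg
  contg := h.contg.neg
  derivf r hr := (h.derivf r hr).neg.congr_deriv (by ring)
  derivg r hr := (h.derivg r hr).neg.congr_deriv (by ring)
  damp_mem := h.damp_mem
  damp_one r hr := by simpa using h.damp_one r hr
  g_lt r hr := by simpa using h.g_lt r hr
  gap r hr := by simpa using h.gap r hr
  ne_zero r hr := by simpa using h.ne_zero r hr

theorem ham_deriv (h : IsDampedOrbit a b δ f g d) {r : ℝ} (hr : 0 < r) :
    HasDerivAt (fun r => Ham a b (f r) (g r)) (-(2 * d r / r) * f r ^ 2 * (1 - g r ^ 2)) r :=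
  hasDerivAt_ham (h.derivf r hr) (h.derivg r hr)

theorem ham_cont (h : IsDampedOrbit a b δ f g d) :
    ContinuousOn (fun r => Ham a b (f r) (g r)) (Ici 0) := continuousOn_ham h.contf h.contg

theorem ham_anti (h : IsDampedOrbit a b δ f g d) {s t : ℝ} (hs : 0 ≤ s) (hst : s ≤ t) :
    Ham a b (f t) (g t) ≤ Ham a b (f s) (g s) := by
  have := le_of_hasDerivAt_nonneg (u := fun r => -Ham a b (f r) (g r)) hst
    ((h.ham_cont.mono (Icc_subset_Ici_self.trans (Ici_subset_Ici.2 hs))).neg) (by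
    intro r hr
    have hr0 : 0 < r := hs.trans_lt hr.1
    refine ⟨_, (h.ham_deriv hr0).neg, ?_⟩
    have h1 := (h.damp_mem r).1
    have h2 := h.g_lt r hr0.le
    have : 0 ≤ (2 * d r / r) * f r ^ 2 * (1 - g r ^ 2) := by
      have : 0 ≤ 1 - g r ^ 2 := by linarith
      positivity
    linarith)
  simpa using this

theorem cont_f_Icc (h : IsDampedOrbit a b δ f g d) {s t : ℝ} (hs : 0 ≤ s) :
    ContinuousOn f (Icc s t) := h.contf.mono (Icc_subset_Ici_self.trans (Ici_subset_Ici.2 hs))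

theorem cont_g_Icc (h : IsDampedOrbit a b δ f g d) {s t : ℝ} (hs : 0 ≤ s) :
    ContinuousOn g (Icc s t) := h.contg.mono (Icc_subset_Ici_self.trans (Ici_subset_Ici.2 hs))

theorem cont_ham_Icc (h : IsDampedOrbit a b δ f g d) {s t : ℝ} (hs : 0 ≤ s) :
    ContinuousOn (fun r => Ham a b (f r) (g r)) (Icc s t) :=
  h.ham_cont.mono (Icc_subset_Ici_self.trans (Ici_subset_Ici.2 hs))

theorem a_pos (h : IsDampedOrbit a b δ f g d) : 0 < a := by
  have := h.hb; have := h.hab; linarith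

theorem f_sq_lt (h : IsDampedOrbit a b δ f g d) {r : ℝ} (hr : 0 ≤ r) :
    2 * f r ^ 2 < a * g r ^ 2 + a - 2 * b := by
  have h1 := h.gap r hr
  have h2 := h.g_lt r hr
  have h3 := h.hδ
  by_contra hc
  push Not at hc
  nlinarith

theorem f_sq_lt' (h : IsDampedOrbit a b δ f g d) {r : ℝ} (hr : 0 ≤ r) :
    f r ^ 2 < a - b := by
  have h1 := h.f_sq_lt hr
  have h2 := h.g_lt r hr
  nlinarith [h.a_pos]

theorem abs_f_lt (h : IsDampedOrbit a b δ f g d) {r : ℝ} (hr : 0 ≤ r) :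
    |f r| < √(a - b) := by
  rw [← Real.sqrt_sq_eq_abs]
  exact Real.sqrt_lt_sqrt (sq_nonneg _) (h.f_sq_lt' hr)

theorem abs_g_lt (h : IsDampedOrbit a b δ f g d) {r : ℝ} (hr : 0 ≤ r) : |g r| < 1 := by
  rw [← sq_lt_one_iff_abs_lt_one]
  exact h.g_lt r hr

/-- The distance of `g` to the invariant lines `g = ±1` is bounded below. -/
theorem le_one_sub_g_sq (h : IsDampedOrbit a b δ f g d) {r : ℝ} (hr : 0 ≤ r) :
    2 * δ / (a - b) ≤ 1 - g r ^ 2 := by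
  have h1 := h.gap r hr
  have h2 := h.g_lt r hr
  have h3 := h.hab
  have h4 := h.hb
  have h5 := h.f_sq_lt hr
  rw [div_le_iff₀ (by linarith)]
  have h6 : a * g r ^ 2 + a - 2 * b - 2 * f r ^ 2 ≤ 2 * (a - b) := by
    nlinarith [sq_nonneg (f r), h.a_pos]
  nlinarith [mul_le_mul_of_nonneg_left h6 (sub_nonneg.2 h2.le)]

theorem two_mul_ham (a b f g : ℝ) :
    f ^ 2 * (1 - g ^ 2) = 2 * Ham a b f g - a / 2 * g ^ 4 + b * g ^ 2 := by
  unfold Ham; ring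

/-- Near `g = 0` the energy controls `f` from below. -/
theorem le_f_sq_mul {r : ℝ} (hg : a * g r ^ 2 ≤ b) :
    2 * Ham a b (f r) (g r) + b / 2 * g r ^ 2 ≤ f r ^ 2 * (1 - g r ^ 2) := by
  rw [two_mul_ham a b]
  nlinarith [sq_nonneg (g r)]

end IsDampedOrbit

namespace IsDampedOrbit

variable {a b δ : ℝ} {f g d : ℝ → ℝ}

/-- When `f` is small and the energy is positive, `f` is pushed towards the opposite sign of `g`. -/
theorem deriv_f_le (h : IsDampedOrbit a b δ f g d) {γ m r : ℝ} (hγ : 0 < γ)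
    (hγ2 : a * γ ^ 2 = b) (hm : 0 < m) (hm2 : m ^ 2 * (1 + 8 * a / b) ≤ b / 2) (hr0 : 0 < r)
    (hr : 16 * m ≤ r * (γ * b))
    (hg : γ / 2 ≤ g r) (hH : 0 < Ham a b (f r) (g r)) (hf : |f r| ≤ m) :
    g r * (f r ^ 2 - a * g r ^ 2 + b) - 2 * d r / r * f r ≤ -(γ * b / 8) := by
  have hb := h.hb
  have ha := h.a_pos
  have hf2 : f r ^ 2 ≤ m ^ 2 := by rw [← sq_abs]; gcongr
  have hg1 := h.g_lt r hr0.le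
  have hg0 : 0 < g r := by linarith
  have h1 : g r ^ 2 * (b - a / 2 * g r ^ 2) < m ^ 2 := by
    have := two_mul_ham a b (f r) (g r)
    nlinarith [sq_nonneg (f r), sq_nonneg (g r)]
  have hg2 : b / (4 * a) ≤ g r ^ 2 := by
    have : (γ / 2) ^ 2 ≤ g r ^ 2 := by gcongr
    rw [div_le_iff₀ (by positivity)]
    nlinarith
  have h2 : b - a / 2 * g r ^ 2 ≤ m ^ 2 * (4 * a / b) := by
    by_contra hc
    push Not at hc
    have hpos : 0 < b - a / 2 * g r ^ 2 := lt_of_le_of_lt (by positivity) hc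
    have h3 : b / (4 * a) * (m ^ 2 * (4 * a / b)) = m ^ 2 := by field_simp
    have h4 : b / (4 * a) * (m ^ 2 * (4 * a / b)) ≤ g r ^ 2 * (b - a / 2 * g r ^ 2) := by
      gcongr
    linarith
  have h3 : f r ^ 2 - a * g r ^ 2 + b ≤ -(b / 2) := by
    have : m ^ 2 * (1 + 8 * a / b) = m ^ 2 + 2 * (m ^ 2 * (4 * a / b)) := by ring
    linarith
  have h4 : -(2 * d r / r * f r) ≤ γ * b / 8 := by
    have hd := h.damp_mem r
    have hd0 : 0 ≤ 2 * d r / r := by have := hd.1; positivity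
    have h5 : -f r ≤ m := (neg_le_abs _).trans hf
    calc -(2 * d r / r * f r) = 2 * d r / r * (-f r) := by ring
      _ ≤ 2 * d r / r * m := by gcongr
      _ ≤ 2 * 1 / r * m := by gcongr; exact hd.2
      _ ≤ γ * b / 8 := by
        rw [div_mul_eq_mul_div, div_le_iff₀ hr0]; linarith
  have h5 : g r * (f r ^ 2 - a * g r ^ 2 + b) ≤ γ / 2 * (-(b / 2)) := by nlinarith
  linarith

theorem hasDerivAt_phase (h : IsDampedOrbit a b δ f g d) {r N : ℝ} (hr : 0 < r) :
    HasDerivAt (fun r => arctan (N * f r) * (2 - g r))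
      (N / (1 + (N * f r) ^ 2) *
        (g r * (f r ^ 2 - a * g r ^ 2 + b) - 2 * d r / r * f r) * (2 - g r)
        - arctan (N * f r) * f r * (1 - g r ^ 2)) r := by
  refine ((((h.derivf r hr).const_mul N).arctan).mul ((h.derivg r hr).const_sub 2)).congr_deriv ?_
  ring

theorem mul_arctan_nonneg {N x : ℝ} (hN : 0 ≤ N) : 0 ≤ arctan (N * x) * x := by
  rcases le_total 0 x with hx | hx
  · exact mul_nonneg (arctan_nonneg.2 (mul_nonneg hN hx)) hx
  · exact mul_nonneg_of_nonpos_of_nonpos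
      (arctan_le_zero.2 (mul_nonpos_of_nonneg_of_nonpos hN hx)) hx

theorem le_mul_arctan {N m x : ℝ} (hm : 0 < m) (hN : 1 ≤ N * m) (hx : m ≤ |x|) :
    3 / 4 * m ≤ arctan (N * x) * x := by
  have hN0 : 0 < N := by
    by_contra hc
    push Not at hc
    nlinarith
  have h1 : arctan (N * x) * x = arctan (N * |x|) * |x| := by
    rcases abs_cases x with ⟨hx, -⟩ | ⟨hx, -⟩ <;> rw [hx]
    rw [mul_neg, mul_neg, arctan_neg, neg_mul, neg_neg]
  rw [h1]
  have h2 : π / 4 ≤ arctan (N * |x|) := by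
    rw [← arctan_one]
    exact arctan_mono (hN.trans (by gcongr))
  have := pi_gt_three
  have h3 : 3 / 4 ≤ arctan (N * |x|) := by linarith
  gcongr

/-- Away from `g = 0`, an orbit with positive energy turns at a definite rate. -/
theorem exists_phase_rate {γ : ℝ} (hγ : 0 < γ) (hγ2 : a * γ ^ 2 = b) (hδ : 0 < δ)
    (hb : 0 < b) (hab : 2 * b < a) :
    ∃ N c R : ℝ, 0 < N ∧ 0 < c ∧ 0 < R ∧ ∀ f g d : ℝ → ℝ, IsDampedOrbit a b δ f g d →
      ∀ r, R ≤ r → γ / 2 ≤ g r → 0 < Ham a b (f r) (g r) →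
      N / (1 + (N * f r) ^ 2) *
        (g r * (f r ^ 2 - a * g r ^ 2 + b) - 2 * d r / r * f r) * (2 - g r)
        - arctan (N * f r) * f r * (1 - g r ^ 2) ≤ -c := by
  have ha : 0 < a := by linarith
  have hab' : 0 < a - b := by linarith
  obtain ⟨m, hm, hm2⟩ : ∃ m : ℝ, 0 < m ∧ m ^ 2 * (1 + 8 * a / b) ≤ b / 2 := by
    refine ⟨√(b / (2 * (1 + 8 * a / b))), by positivity, ?_⟩
    rw [Real.sq_sqrt (by positivity)]
    refine le_of_eq ?_
    field_simp
  obtain ⟨κ, hκ, hκdef⟩ : ∃ κ : ℝ, 0 < κ ∧ κ = 2 * δ / (a - b) := ⟨_, by positivity, rfl⟩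
  obtain ⟨M, hM, hMdef⟩ : ∃ M : ℝ, 0 < M ∧ M = √(a - b) := ⟨_, by positivity, rfl⟩
  obtain ⟨N, hN, hN1, hN2⟩ : ∃ N : ℝ, 0 < N ∧ 1 ≤ N * m ∧
      2 * (a + M) ≤ N * m ^ 2 * (m * κ / 2) := by
    refine ⟨max (1 / m) (4 * (a + M) / (m ^ 3 * κ)), by positivity, ?_, ?_⟩
    · rw [← div_le_iff₀ hm]; exact le_max_left _ _
    · have : 4 * (a + M) ≤ max (1 / m) (4 * (a + M) / (m ^ 3 * κ)) * (m ^ 3 * κ) := by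
        rw [← div_le_iff₀ (by positivity)]; exact le_max_right _ _
      linarith
  refine ⟨N, min (N / (1 + (N * m) ^ 2) * (γ * b / 8)) (m * κ / 4), max 2 (16 * m / (γ * b)), hN,
    by positivity, by positivity, fun f g d h r hr hg hH => ?_⟩
  have hr2 : 2 ≤ r := (le_max_left _ _).trans hr
  have hr0 : 0 < r := by linarith
  have hr3 : 16 * m ≤ r * (γ * b) := by
    rw [← div_le_iff₀ (by positivity)]; exact (le_max_right _ _).trans hr
  have hg1 := (abs_lt.1 (h.abs_g_lt hr0.le)).2
  have hg0 : 0 < g r := by linarith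
  have hw : κ ≤ 1 - g r ^ 2 := hκdef ▸ h.le_one_sub_g_sq hr0.le
  rcases le_total |f r| m with hf | hf
  · refine le_trans ?_ (neg_le_neg (min_le_left _ _))
    have h1 := h.deriv_f_le hγ hγ2 hm hm2 hr0 hr3 hg hH hf
    have h2 : N / (1 + (N * m) ^ 2) ≤ N / (1 + (N * f r) ^ 2) := by
      have : (N * f r) ^ 2 ≤ (N * m) ^ 2 := by
        rw [mul_pow, mul_pow, ← sq_abs (f r)]; gcongr
      gcongr
    have h3 : 0 ≤ arctan (N * f r) * f r * (1 - g r ^ 2) :=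
      mul_nonneg (mul_arctan_nonneg hN.le) (by linarith)
    have h4 : 0 < N / (1 + (N * m) ^ 2) := by positivity
    have hgb : 0 < γ * b / 8 := by positivity
    have h5 : N / (1 + (N * m) ^ 2) * (γ * b / 8) ≤ N / (1 + (N * f r) ^ 2) *
        -(g r * (f r ^ 2 - a * g r ^ 2 + b) - 2 * d r / r * f r) := by
      refine mul_le_mul h2 (by linarith) hgb.le (by positivity)
    have h6 : 0 < N / (1 + (N * m) ^ 2) * (γ * b / 8) := by positivity
    nlinarith
  · refine le_trans ?_ (neg_le_neg (min_le_right _ _))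
    have h1 := le_mul_arctan hm hN1 hf
    have h2 : 3 / 4 * m * κ ≤ arctan (N * f r) * f r * (1 - g r ^ 2) := by
      refine mul_le_mul h1 hw hκ.le (by linarith [show 0 < m from hm])
    have hfM : |f r| ≤ M := hMdef ▸ (h.abs_f_lt hr0.le).le
    have h3 : g r * (f r ^ 2 - a * g r ^ 2 + b) - 2 * d r / r * f r ≤ a + M := by
      have h4 : -(2 * d r / r * f r) ≤ M := by
        have hd := h.damp_mem r
        have hd0 : 0 ≤ 2 * d r / r := by have := hd.1; positivity
        have h5 : -f r ≤ M := (neg_le_abs _).trans hfM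
        calc -(2 * d r / r * f r) = 2 * d r / r * (-f r) := by ring
          _ ≤ 2 * d r / r * M := by gcongr
          _ ≤ 2 * 1 / 2 * M := by gcongr; exact hd.2
          _ = M := by ring
      have h5 : f r ^ 2 - a * g r ^ 2 + b ≤ a := by
        have := h.f_sq_lt' hr0.le
        nlinarith [sq_nonneg (g r)]
      have h6 : g r * (f r ^ 2 - a * g r ^ 2 + b) ≤ a := by
        nlinarith
      linarith
    have h7 : N / (1 + (N * f r) ^ 2) ≤ 1 / (N * m ^ 2) := by
      rw [div_le_div_iff₀ (by positivity) (by positivity)]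
      have : m ^ 2 ≤ f r ^ 2 := by rw [← sq_abs (f r)]; gcongr
      have : N ^ 2 * m ^ 2 ≤ N ^ 2 * f r ^ 2 := by gcongr
      nlinarith
    have h8 : N / (1 + (N * f r) ^ 2) *
        (g r * (f r ^ 2 - a * g r ^ 2 + b) - 2 * d r / r * f r) * (2 - g r) ≤
        1 / (N * m ^ 2) * (a + M) * 2 := by
      have : 0 ≤ 2 - g r := by linarith
      calc _ ≤ N / (1 + (N * f r) ^ 2) * (a + M) * (2 - g r) := by gcongr
        _ ≤ 1 / (N * m ^ 2) * (a + M) * 2 := by gcongr; linarith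
    have h9 : 1 / (N * m ^ 2) * (a + M) * 2 ≤ m * κ / 2 := by
      rw [one_div_mul_eq_div, div_mul_eq_mul_div, div_le_iff₀ (by positivity)]
      linarith
    linarith

/-- An orbit with positive energy returns to a neighbourhood of `g = 0` within a uniform time. -/
theorem exists_return_time {γ : ℝ} (hγ : 0 < γ) (hγ2 : a * γ ^ 2 = b) (hδ : 0 < δ)
    (hb : 0 < b) (hab : 2 * b < a) :
    ∃ T R : ℝ, 0 < T ∧ 0 < R ∧ ∀ f g d : ℝ → ℝ, IsDampedOrbit a b δ f g d → ∀ s, R ≤ s →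
      ∃ t ∈ Icc s (s + T), |g t| < γ / 2 ∨ Ham a b (f t) (g t) ≤ 0 := by
  obtain ⟨N, c, R, hN, hc, hR, hrate⟩ := exists_phase_rate hγ hγ2 hδ hb hab
  have hT : 0 < 9 / c := by positivity
  refine ⟨9 / c, R, hT, hR, fun f g d h s hs => ?_⟩
  by_contra hcon
  push Not at hcon
  have hs0 : 0 < s := hR.trans_le hs
  wlog hgs : 0 < g s generalizing f g
  · refine this (fun r => -f r) (fun r => -g r) h.neg ?_ ?_
    · simpa only [abs_neg, ham_neg] using hcon
    · have h1 := (hcon s ⟨le_rfl, by linarith⟩).1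
      have : g s ≠ 0 := fun h0 => by rw [h0, abs_zero] at h1; linarith
      have := lt_of_le_of_ne (not_lt.1 hgs) this
      simpa using this
  have hgpos : ∀ r ∈ Icc s (s + 9 / c), 0 < g r := by
    refine pos_of_ne_zero_on_Icc (h.cont_g_Icc hs0.le) (fun r hr h0 => ?_)
      (left_mem_Icc.2 (by linarith)) hgs
    have h1 := (hcon r hr).1
    rw [h0, abs_zero] at h1; linarith
  have key := mul_sub_le_of_hasDerivAt (u := fun r => -(arctan (N * f r) * (2 - g r)))
    (s := s) (t := s + 9 / c) (c := c) (by linarith) (by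
      have := h.cont_f_Icc (s := s) (t := s + 9 / c) hs0.le
      have := h.cont_g_Icc (s := s) (t := s + 9 / c) hs0.le
      exact ((continuous_arctan.comp_continuousOn (by fun_prop)).mul (by fun_prop)).neg) (by
      intro r hr
      refine ⟨_, (h.hasDerivAt_phase (hs0.trans hr.1)).neg, ?_⟩
      have hr' : r ∈ Icc s (s + 9 / c) := Ioo_subset_Icc_self hr
      have h1 := (hcon r hr').1
      rw [abs_of_pos (hgpos r hr')] at h1
      have := hrate f g d h r (hs.trans hr.1.le) h1 (hcon r hr').2
      linarith)
  have hbound : ∀ r ∈ Icc s (s + 9 / c), |arctan (N * f r) * (2 - g r)| ≤ 4 := by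
    intro r hr
    have h1 := hgpos r hr
    have h2 := (abs_lt.1 (h.abs_g_lt (hs0.le.trans hr.1))).2
    have h3 : |arctan (N * f r)| ≤ 2 := by
      have := pi_le_four
      have h4 := neg_pi_div_two_lt_arctan (N * f r)
      have h5 := arctan_lt_pi_div_two (N * f r)
      rw [abs_le]; constructor <;> linarith
    rw [abs_mul, abs_of_pos (show 0 < 2 - g r by linarith)]
    nlinarith [abs_nonneg (arctan (N * f r))]
  have h1 := abs_le.1 (hbound s (left_mem_Icc.2 (by linarith)))
  have h2 := abs_le.1 (hbound (s + 9 / c) (right_mem_Icc.2 (by linarith)))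
  have h3 : c * (s + 9 / c - s) = 9 := by field_simp; ring
  linarith

end IsDampedOrbit

namespace IsDampedOrbit

variable {a b δ : ℝ} {f g d : ℝ → ℝ}

/-- Crossing the strip `γ / 2 ≤ |g| ≤ γ` inwards costs a definite amount of energy. -/
theorem ham_loss (h : IsDampedOrbit a b δ f g d) {γ μ s t : ℝ} (hγ : 0 < γ)
    (hγ2 : a * γ ^ 2 = b) (hμ : 0 < μ) (hμ2 : μ ^ 2 ≤ b / 8 * γ ^ 2) (hs : 0 < s) (hst : s ≤ t)
    (hgs : γ ≤ |g s|) (hgt : |g t| ≤ γ / 2) (hH : 0 ≤ Ham a b (f t) (g t)) :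
    Ham a b (f t) (g t) + μ * γ / t ≤ Ham a b (f s) (g s) := by
  wlog hpos : 0 ≤ g s generalizing f g
  · have := this h.neg (by simpa only [abs_neg] using hgs) (by simpa only [abs_neg] using hgt)
      (by simpa only [ham_neg] using hH) (by linarith)
    simpa only [ham_neg] using this
  rw [abs_of_nonneg hpos] at hgs
  have hb := h.hb
  have ha := h.a_pos
  obtain ⟨p, q, hsp, hpq, hqt, hp, hq, hpq'⟩ := exists_downcrossing hst
    (h.cont_g_Icc hs.le) hgs ((le_abs_self _).trans hgt)
  have hp0 : 0 < p := hs.trans_le hsp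
  have ht0 : 0 < t := by linarith
  have key := le_of_hasDerivAt_nonneg (u := fun r => 2 * μ / t * g r - Ham a b (f r) (g r)) hpq
    (((h.cont_g_Icc hp0.le).const_mul _).sub (h.cont_ham_Icc hp0.le)) (by
      intro r hr
      have hr0 : 0 < r := hp0.trans hr.1
      refine ⟨_, ((h.derivg r hr0).const_mul _).sub (h.ham_deriv hr0), ?_⟩
      obtain ⟨h1, h2⟩ := hpq' r hr
      have hg0 : 0 < g r := by linarith
      have hg2 : a * g r ^ 2 ≤ b := by
        rw [← hγ2]; gcongr
      have hd := h.damp_one r hr0.le (by linarith)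
      have h3 := le_f_sq_mul (f := f) hg2
      have hHr : 0 ≤ Ham a b (f r) (g r) := hH.trans (h.ham_anti hr0.le (hr.2.le.trans hqt))
      have h4 : (γ / 2) ^ 2 ≤ g r ^ 2 := by gcongr
      have hw : 0 ≤ 1 - g r ^ 2 := by have := h.g_lt r hr0.le; linarith
      have h5 : μ ^ 2 ≤ f r ^ 2 := by nlinarith [sq_nonneg (f r), sq_nonneg (g r)]
      have h6 : μ ≤ |f r| := by
        rw [← sq_abs (f r)] at h5
        exact le_of_sq_le_sq h5 (abs_nonneg _)
      have h7 : -(μ * f r) ≤ f r ^ 2 := by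
        rw [← sq_abs (f r)]
        nlinarith [neg_abs_le (f r), abs_nonneg (f r)]
      have h8 : 2 / t * -(μ * f r) ≤ 2 / r * f r ^ 2 := by
        have : 2 / t ≤ 2 / r := by gcongr; linarith [hr.2]
        calc 2 / t * -(μ * f r) ≤ 2 / t * f r ^ 2 := by gcongr
          _ ≤ 2 / r * f r ^ 2 := by gcongr
      rw [hd]
      have h9 : 0 ≤ (2 / r * f r ^ 2 - 2 / t * -(μ * f r)) * (1 - g r ^ 2) :=
        mul_nonneg (by linarith) hw
      calc (0 : ℝ) ≤ _ := h9
        _ = _ := by ring)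
  have h1 := h.ham_anti hs.le hsp
  have h2 := h.ham_anti (hp0.le.trans hpq) hqt
  have h3 : μ * γ / t ≤ 2 * μ / t * (g p - g q) := by
    have h4 : 0 < 2 * μ / t := by positivity
    calc μ * γ / t = 2 * μ / t * (γ / 2) := by ring
      _ ≤ 2 * μ / t * (g p - g q) := by gcongr; linarith
  linarith

theorem arsinh_le_log {k : ℝ} (hk : 0 ≤ k) : arsinh k ≤ log (1 + 2 * k) := by
  unfold arsinh
  have h : √(1 + k ^ 2) ≤ 1 + k := by
    rw [Real.sqrt_le_iff]; constructor <;> nlinarith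
  have h0 : 0 < √(1 + k ^ 2) := by positivity
  exact log_le_log (by linarith) (by linarith)

/-- The time an orbit with positive energy can spend near `g = 0` is at most logarithmic in the
energy. -/
theorem passage_time (h : IsDampedOrbit a b δ f g d) {γ k s t : ℝ}
    (hγ2 : a * γ ^ 2 = b) (hs : 0 < s) (hst : s ≤ t) (hg' : ∀ r ∈ Ico s t, |g r| < γ)
    (hk : 0 < k) (hH : b ≤ 4 * k ^ 2 * Ham a b (f t) (g t)) :
    √b / 2 * (t - s) ≤ 2 * log (1 + 2 * k) := by
  rcases eq_or_lt_of_le hst with heq | hlt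
  · rw [heq, sub_self, mul_zero]
    have := log_nonneg (show 1 ≤ 1 + 2 * k by linarith)
    positivity
  have hg : ∀ r ∈ Icc s t, |g r| ≤ γ := by
    have hcl : IsClosed (Icc s t ∩ {r | |g r| ≤ γ}) :=
      (h.cont_g_Icc hs.le).abs.preimage_isClosed_of_isClosed isClosed_Icc isClosed_Iic
    have := closure_minimal (fun r (hr : r ∈ Ico s t) =>
      (⟨Ico_subset_Icc_self hr, (hg' r hr).le⟩ : r ∈ Icc s t ∩ {r | |g r| ≤ γ})) hcl
    rw [closure_Ico hlt.ne] at this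
    exact fun r hr => (this hr).2
  clear hg'
  have hb := h.hb
  have ha := h.a_pos
  have hHt : 0 < Ham a b (f t) (g t) := by
    by_contra hc
    push Not at hc
    nlinarith [sq_nonneg k]
  have hg2 : ∀ r ∈ Icc s t, a * g r ^ 2 ≤ b := fun r hr => by
    rw [← hγ2, ← sq_abs (g r)]
    have := hg r hr
    gcongr
  have hlow : ∀ r ∈ Icc s t, 2 * Ham a b (f t) (g t) + b / 2 * g r ^ 2 ≤ f r ^ 2 * (1 - g r ^ 2) :=
    fun r hr => by
      have h1 := le_f_sq_mul (f := f) (hg2 r hr)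
      have h2 := h.ham_anti (hs.le.trans hr.1) hr.2
      linarith
  have hfne : ∀ r ∈ Icc s t, f r ≠ 0 := fun r hr h0 => by
    have := hlow r hr
    rw [h0] at this
    nlinarith [sq_nonneg (g r)]
  wlog hf : 0 < f s generalizing f g
  · refine this h.neg (by simpa only [ham_neg] using hH) (by simpa only [abs_neg] using hg)
      (by simpa only [ham_neg] using hHt) (by simpa only [neg_sq] using hg2)
      (by simpa only [ham_neg, neg_sq] using hlow) (fun r hr => neg_ne_zero.2 (hfne r hr)) ?_
    have := lt_of_le_of_ne (not_lt.1 hf) (hfne s (left_mem_Icc.2 hst))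
    linarith
  have hfpos := pos_of_ne_zero_on_Icc (h.cont_f_Icc hs.le) hfne (left_mem_Icc.2 hst) hf
  have key := mul_sub_le_of_hasDerivAt (u := fun r => arsinh (k * g r)) (c := √b / 2) hst
    (continuous_arsinh.comp_continuousOn ((h.cont_g_Icc hs.le).const_mul k)) (by
      intro r hr
      have hr' := Ioo_subset_Icc_self hr
      refine ⟨_, HasDerivAt.arsinh ((h.derivg r (hs.trans hr.1)).const_mul k), ?_⟩
      have h1 := hlow r hr'
      have h2 := hg2 r hr'
      have h3 := hfpos r hr'
      have h4 : (1 : ℝ) / 2 ≤ 1 - g r ^ 2 := by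
        have : a * g r ^ 2 ≤ a * (1 / 2) := by linarith [h.hab]
        have := le_of_mul_le_mul_left this ha
        linarith
      have hq : 0 < √(1 + (k * g r) ^ 2) := by positivity
      rw [smul_eq_mul, inv_mul_eq_div, le_div_iff₀ hq]
      refine le_of_sq_le_sq ?_ (by positivity)
      rw [mul_pow, div_pow, Real.sq_sqrt hb.le, Real.sq_sqrt (by positivity)]
      have h5 : Ham a b (f t) (g t) + b / 4 * g r ^ 2 ≤ (f r * (1 - g r ^ 2)) ^ 2 := by
        have h6 : 0 ≤ f r ^ 2 * (1 - g r ^ 2) := by positivity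
        nlinarith
      have h6 : k ^ 2 * (Ham a b (f t) (g t) + b / 4 * g r ^ 2) ≤
          k ^ 2 * (f r * (1 - g r ^ 2)) ^ 2 := by gcongr
      nlinarith)
  have hγ1 : ∀ r ∈ Icc s t, |g r| ≤ 1 := fun r hr => (h.abs_g_lt (hs.le.trans hr.1)).le
  have h1 : arsinh (k * g t) ≤ arsinh k := by
    rw [arsinh_le_arsinh]
    have := (abs_le.1 (hγ1 t (right_mem_Icc.2 hst))).2
    nlinarith
  have h2 : -arsinh k ≤ arsinh (k * g s) := by
    rw [← arsinh_neg, arsinh_le_arsinh]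
    have := (abs_le.1 (hγ1 s (left_mem_Icc.2 hst))).1
    nlinarith
  have h3 := arsinh_le_log hk.le
  linarith

/-- Energy loss in one excursion away from `g = 0`. -/
theorem exists_excursion_loss {γ : ℝ} (hγ : 0 < γ) (hγ2 : a * γ ^ 2 = b) (hδ : 0 < δ)
    (hb : 0 < b) (hab : 2 * b < a) :
    ∃ c T R : ℝ, 0 < c ∧ 0 < T ∧ 0 < R ∧ ∀ f g d : ℝ → ℝ, IsDampedOrbit a b δ f g d →
      ∀ s, R ≤ s → γ ≤ |g s| →
        (0 < Ham a b (f (s + T)) (g (s + T)) →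
          Ham a b (f (s + T)) (g (s + T)) + c / (s + T) ≤ Ham a b (f s) (g s)) ∧
        (∀ t, s ≤ t → g t = 0 → 0 < Ham a b (f t) (g t) → c / (s + T) ≤ Ham a b (f s) (g s)) := by
  obtain ⟨T, R, hT, hR, hret⟩ := exists_return_time hγ hγ2 hδ hb hab
  obtain ⟨μ, hμ, hμ2⟩ : ∃ μ : ℝ, 0 < μ ∧ μ ^ 2 ≤ b / 8 * γ ^ 2 :=
    ⟨√(b / 8 * γ ^ 2), by positivity, (Real.sq_sqrt (by positivity)).le⟩
  refine ⟨μ * γ, T, R, by positivity, hT, hR, fun f g d h s hs hgs => ?_⟩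
  have hs0 : 0 < s := hR.trans_le hs
  obtain ⟨t, ht, hcase⟩ := hret f g d h s hs
  have ht0 : 0 < t := hs0.trans_le ht.1
  have hdiv : μ * γ / (s + T) ≤ μ * γ / t := by gcongr; exact ht.2
  constructor
  · intro hH
    have h1 := h.ham_anti ht0.le ht.2
    rcases hcase with hg | hH'
    · have := h.ham_loss hγ hγ2 hμ hμ2 hs0 ht.1 hgs hg.le (by linarith)
      linarith
    · linarith
  · intro q hsq hgq hHq
    rcases le_total q t with hqt | hqt
    · have hq0 : 0 < q := hs0.trans_le hsq
      have := h.ham_loss hγ hγ2 hμ hμ2 hs0 hsq hgs (by rw [hgq, abs_zero]; positivity) hHq.le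
      have : μ * γ / (s + T) ≤ μ * γ / q := by gcongr; exact hqt.trans ht.2
      linarith
    · have h1 := h.ham_anti ht0.le hqt
      rcases hcase with hg | hH'
      · have := h.ham_loss hγ hγ2 hμ hμ2 hs0 ht.1 hgs hg.le (by linarith)
        linarith
      · linarith

theorem eventually_le_two_mul {B D : ℝ} (hB : 0 ≤ B) (hD : 0 < D) :
    ∃ C R : ℝ, 0 < C ∧ 3 ≤ R ∧ ∀ r τ : ℝ, R ≤ r → r ≤ τ → τ ≤ r + B + D * log τ →
      τ ≤ 2 * r ∧ τ - r ≤ C * log r := by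
  have h1 := Real.isLittleO_log_id_atTop.def (c := 1 / (4 * D)) (by positivity)
  obtain ⟨R, hR⟩ := eventually_atTop.1 h1
  refine ⟨B + D * 2, max R (max 3 (4 * B)), by positivity,
    (le_max_left _ _).trans (le_max_right _ _), fun r τ hr hrτ hle => ?_⟩
  have hr1 : R ≤ r := (le_max_left _ _).trans hr
  have hr3 : 3 ≤ r := ((le_max_left _ _).trans (le_max_right _ _)).trans hr
  have hrB : 4 * B ≤ r := ((le_max_right _ _).trans (le_max_right _ _)).trans hr
  have h2 := hR τ (hr1.trans hrτ)
  rw [id, norm_eq_abs, norm_eq_abs, abs_of_pos (by linarith : 0 < τ)] at h2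
  have h3 : D * log τ ≤ τ / 4 := by
    calc D * log τ ≤ D * (1 / (4 * D) * τ) := by gcongr; exact (le_abs_self _).trans h2
      _ = τ / 4 := by field_simp
  have h4 : τ ≤ 2 * r := by linarith
  refine ⟨h4, ?_⟩
  have hlog1 : 1 ≤ log r := by
    rw [le_log_iff_exp_le (by linarith)]
    exact exp_one_lt_three.le.trans hr3
  have h5 : log τ ≤ 2 * log r := by
    have : log τ ≤ log (r ^ 2) := log_le_log (by linarith) (by nlinarith)
    rwa [log_pow] at this
  nlinarith

/-- Time needed to leave the neighbourhood of `g = 0` before the next excursion. -/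
theorem exists_passage_bound {γ c T : ℝ} (hγ2 : a * γ ^ 2 = b) (hb : 0 < b)
    (hc : 0 < c) (hT : 0 < T) :
    ∃ C R : ℝ, 0 < C ∧ 3 ≤ R ∧ ∀ f g d : ℝ → ℝ, IsDampedOrbit a b δ f g d →
      ∀ r t, R ≤ r → r ≤ t → (∀ q ∈ Ico r t, |g q| < γ) →
        c / (t + T) ≤ Ham a b (f t) (g t) → t + T ≤ 2 * r ∧ t + T - r ≤ C * log r := by
  obtain ⟨A, hA1, hA⟩ : ∃ A : ℝ, 1 ≤ A ∧ b ≤ 4 * A * c := by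
    refine ⟨max 1 (b / (4 * c)), le_max_left _ _, ?_⟩
    have : b / (4 * c) ≤ max 1 (b / (4 * c)) := le_max_right _ _
    rw [div_le_iff₀ (by positivity)] at this
    linarith
  have hsb : 0 < √b := by positivity
  have hlogA : 0 ≤ log (3 * A) := log_nonneg (by linarith)
  obtain ⟨C, R, hC, hR, hmain⟩ := eventually_le_two_mul (B := T + 4 / √b * log (3 * A))
    (D := 4 / √b) (by positivity) (by positivity)
  refine ⟨C, R, hC, hR, fun f g d h r t hr hrt hg hH => hmain r (t + T) hr (by linarith) ?_⟩
  have ht3 : 3 ≤ t := by linarith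
  have hτ : 1 ≤ t + T := by linarith
  have h1 := h.passage_time (k := A * (t + T)) hγ2 (by linarith) hrt hg (by positivity) (by
    calc b ≤ 4 * A * c * 1 * 1 := by linarith
      _ ≤ 4 * A * c * A * (t + T) := by gcongr
      _ = 4 * (A * (t + T)) ^ 2 * (c / (t + T)) := by field_simp
      _ ≤ _ := by gcongr)
  have h2 : log (1 + 2 * (A * (t + T))) ≤ log (3 * A) + log (t + T) := by
    rw [← log_mul (by positivity) (by positivity)]
    refine log_le_log (by positivity) ?_
    nlinarith
  have h3 : t - r ≤ 4 / √b * (log (3 * A) + log (t + T)) := by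
    rw [div_mul_eq_mul_div, le_div_iff₀ hsb]
    linarith
  linarith

/-- An orbit whose energy stays positive eventually stays close to `g = 0`. -/
theorem eventually_abs_g_lt (h : IsDampedOrbit a b δ f g d) {γ : ℝ} (hγ : 0 < γ)
    (hγ2 : a * γ ^ 2 = b) (hH : ∀ r, 0 ≤ r → 0 < Ham a b (f r) (g r)) :
    ∃ R, 0 < R ∧ ∀ r, R ≤ r → |g r| < γ := by
  by_contra hcon
  push Not at hcon
  obtain ⟨c, T, R₁, hc, hT, hR₁, hloss⟩ := exists_excursion_loss hγ hγ2 h.hδ h.hb h.hab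
  obtain ⟨C, R₂, hC, hR₂, hpass⟩ := exists_passage_bound (δ := δ) hγ2 h.hb hc hT
  set R := max R₁ R₂
  have hR3 : 3 ≤ R := hR₂.trans (le_max_right _ _)
  have step : ∀ r, R ≤ r → ∃ τ, r + T ≤ τ ∧
      Ham a b (f τ) (g τ) + c / (2 * C) * log (log τ) ≤
        Ham a b (f r) (g r) + c / (2 * C) * log (log r) := by
    intro r hr
    have hr3 : 3 ≤ r := hR3.trans hr
    have hr0 : 0 < r := by linarith
    obtain ⟨q, hq, hgq⟩ := hcon r hr0
    obtain ⟨t, ht, hgt, hbefore⟩ := exists_first_mem hq (h.cont_g_Icc hr0.le).abs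
      (isClosed_Ici (a := γ)) hgq
    have ht0 : 0 < t := hr0.trans_le ht.1
    have hl := (hloss f g d h t ((le_max_left _ _).trans (hr.trans ht.1)) hgt).1
      (hH _ (by linarith))
    have hcT : c / (t + T) ≤ Ham a b (f t) (g t) := by
      have := hH (t + T) (by linarith); linarith
    obtain ⟨hτ1, hτ2⟩ := hpass f g d h r t ((le_max_right _ _).trans hr) ht.1
      (fun q hq => not_le.1 (hbefore q hq)) hcT
    refine ⟨t + T, by linarith [ht.1], ?_⟩
    have hlogr : 0 < log r := log_pos (by linarith)
    have hlogτ : 0 < log (t + T) := log_pos (by linarith [ht.1])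
    have h1 : log (log (t + T)) - log (log r) ≤ C / r := by
      rw [← log_div hlogτ.ne' hlogr.ne']
      have h2 : log (t + T) - log r ≤ (t + T - r) / r := by
        rw [← log_div (by positivity) (by positivity), sub_div, div_self hr0.ne']
        exact log_le_sub_one_of_pos (by positivity)
      calc log (log (t + T) / log r) ≤ log (t + T) / log r - 1 :=
            log_le_sub_one_of_pos (by positivity)
        _ = (log (t + T) - log r) / log r := by field_simp
        _ ≤ ((C * log r) / r) / log r := by gcongr; exact h2.trans (by gcongr)
        _ = C / r := by field_simp
    have h3 : c / (2 * C) * (log (log (t + T)) - log (log r)) ≤ c / (t + T) := by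
      calc c / (2 * C) * (log (log (t + T)) - log (log r)) ≤ c / (2 * C) * (C / r) := by gcongr
        _ = c / (2 * r) := by field_simp
        _ ≤ c / (t + T) := by gcongr
    have h4 := h.ham_anti hr0.le ht.1
    linarith
  have iter : ∀ n : ℕ, ∃ τ, R + n * T ≤ τ ∧
      Ham a b (f τ) (g τ) + c / (2 * C) * log (log τ) ≤
        Ham a b (f R) (g R) + c / (2 * C) * log (log R) := by
    intro n
    induction n with
    | zero => exact ⟨R, by simp, le_rfl⟩
    | succ n ih =>
      obtain ⟨τ, hτ, hle⟩ := ih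
      have : 0 ≤ (n : ℝ) * T := by positivity
      obtain ⟨τ', hτ', hle'⟩ := step τ (by linarith)
      refine ⟨τ', ?_, hle'.trans hle⟩
      push_cast
      linarith
  have hlim : Tendsto (fun τ : ℝ => c / (2 * C) * log (log τ)) atTop atTop :=
    (tendsto_log_atTop.comp tendsto_log_atTop).const_mul_atTop (by positivity)
  obtain ⟨S, hS⟩ := eventually_atTop.1 (hlim.eventually_gt_atTop
    (Ham a b (f R) (g R) + c / (2 * C) * log (log R)))
  obtain ⟨n, hn⟩ := exists_nat_ge (S / T)
  rw [div_le_iff₀ hT] at hn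
  obtain ⟨τ, hτ, hle⟩ := iter n
  have h1 := hS τ (by linarith)
  have h2 := hH τ (by have : 0 ≤ (n : ℝ) * T := by positivity
                      linarith)
  linarith

end IsDampedOrbit

theorem exists_tendsto_of_antitoneOn {u : ℝ → ℝ} {R m : ℝ} (hu : AntitoneOn u (Ici R))
    (hm : ∀ r, R ≤ r → m ≤ u r) : ∃ L, Tendsto u atTop (𝓝 L) := by
  have hanti : Antitone fun r => u (max R r) := fun r s hrs =>
    hu (mem_Ici.2 (le_max_left _ _)) (mem_Ici.2 (le_max_left _ _)) (max_le_max le_rfl hrs)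
  refine ⟨_, (tendsto_atTop_ciInf hanti ⟨m, ?_⟩).congr' ?_⟩
  · rintro _ ⟨r, rfl⟩
    exact hm _ (le_max_left _ _)
  · filter_upwards [eventually_ge_atTop R] with r hr
    rw [max_eq_right hr]

/-- A function with nonzero derivative at a zero changes sign there. -/
theorem eventually_mul_pos_of_hasDerivAt {u : ℝ → ℝ} {z c : ℝ} (hu : HasDerivAt u c z)
    (hc : c ≠ 0) (hz : u z = 0) :
    ∃ ε > 0, ∀ r, 0 < |r - z| → |r - z| < ε → 0 < (r - z) * u r * c := by
  have h1 : Tendsto (fun r => slope u z r * c) (𝓝[≠] z) (𝓝 (c * c)) :=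
    (hasDerivAt_iff_tendsto_slope.1 hu).mul_const c
  have h2 := h1.eventually_const_lt (mul_self_pos.2 hc)
  rw [eventually_nhdsWithin_iff, Metric.eventually_nhds_iff] at h2
  obtain ⟨ε, hε, h⟩ := h2
  refine ⟨ε, hε, fun r hr0 hr => ?_⟩
  have hne : r ≠ z := sub_ne_zero.1 (abs_pos.1 hr0)
  have h3 := h (by rwa [Real.dist_eq]) hne
  rw [slope_def_field, hz, sub_zero] at h3
  have h4 : 0 < (r - z) ^ 2 := by rw [← sq_abs]; positivity
  have h5 : (r - z) * u r * c = (r - z) ^ 2 * (u r / (r - z) * c) := by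
    have := sub_ne_zero.2 hne
    field_simp
  rw [h5]
  positivity

theorem changesSignAt_of_hasDerivAt {u : ℝ → ℝ} {z c : ℝ} (hu : HasDerivAt u c z)
    (hc : c ≠ 0) (hz : u z = 0) (hz0 : 0 < z) : ChangesSignAt u (Ioi 0) z := by
  obtain ⟨ε, hε, h⟩ := eventually_mul_pos_of_hasDerivAt hu hc hz
  have key : ∀ ρ, 0 < ρ → ρ < ε → u (z - ρ) * u (z + ρ) < 0 := by
    intro ρ hρ hρε
    have h1 := h (z - ρ) (by rw [sub_sub_cancel_left, abs_neg, abs_of_pos hρ]; exact hρ)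
      (by rw [sub_sub_cancel_left, abs_neg, abs_of_pos hρ]; exact hρε)
    have h2 := h (z + ρ) (by rw [add_sub_cancel_left, abs_of_pos hρ]; exact hρ)
      (by rw [add_sub_cancel_left, abs_of_pos hρ]; exact hρε)
    rw [sub_sub_cancel_left] at h1
    rw [add_sub_cancel_left] at h2
    have h3 := mul_pos h1 h2
    have h4 : -ρ * u (z - ρ) * c * (ρ * u (z + ρ) * c) =
        -(u (z - ρ) * u (z + ρ)) * (ρ ^ 2 * c ^ 2) := by ring
    rw [h4] at h3
    have h5 : 0 < ρ ^ 2 * c ^ 2 := by positivity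
    have := pos_of_mul_pos_left h3 h5.le
    linarith
  have hmin : 0 < min (ε / 2) (z / 2) := by positivity
  have h1 : min (ε / 2) (z / 2) ≤ ε / 2 := min_le_left _ _
  have h2 : min (ε / 2) (z / 2) ≤ z / 2 := min_le_right _ _
  refine ⟨hz, min (ε / 2) (z / 2), hmin, fun r hr => ?_, key _ hmin (by linarith), fun r hr =>
    (key r hr.1 (by linarith [hr.2])).le⟩
  have := hr.1
  simp only [mem_Ioi]
  linarith

theorem continuous_ham (a b : ℝ) : Continuous fun p : ℝ × ℝ => Ham a b p.1 p.2 := by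
  unfold Ham; fun_prop

namespace IsDampedOrbit

variable {a b δ : ℝ} {f g d : ℝ → ℝ}

theorem deriv_g_ne_zero (h : IsDampedOrbit a b δ f g d) {r : ℝ} (hr : 0 ≤ r) (hg : g r = 0) :
    f r * (1 - g r ^ 2) ≠ 0 := by
  have : f r ≠ 0 := fun h0 => h.ne_zero r hr h0 hg
  rw [hg]; simpa using this

theorem changesSignAt_iff (h : IsDampedOrbit a b δ f g d) {r : ℝ} :
    ChangesSignAt g (Ioi 0) r ↔ 0 < r ∧ g r = 0 := by
  constructor
  · rintro ⟨hr, ε, hε, hsub, -⟩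
    exact ⟨hsub ⟨by linarith, by linarith⟩, hr⟩
  · rintro ⟨hr, hg⟩
    exact changesSignAt_of_hasDerivAt (h.derivg r hr) (h.deriv_g_ne_zero hr.le hg) hg hr

theorem ham_pos_of_zero (h : IsDampedOrbit a b δ f g d) {r : ℝ} (hr : 0 ≤ r) (hg : g r = 0) :
    0 < Ham a b (f r) (g r) := by
  have : f r ≠ 0 := fun h0 => h.ne_zero r hr h0 hg
  unfold Ham
  rw [hg]
  have : 0 < f r ^ 2 := by positivity
  linarith

theorem f_ne_zero_of_small (h : IsDampedOrbit a b δ f g d) {γ r : ℝ}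
    (hγ2 : a * γ ^ 2 = b) (hg : |g r| ≤ γ) (hH : 0 < Ham a b (f r) (g r)) :
    f r ≠ 0 := by
  intro h0
  have ha := h.a_pos
  have hg2 : a * g r ^ 2 ≤ b := by
    rw [← hγ2, ← sq_abs (g r)]; gcongr
  have := le_f_sq_mul (f := f) hg2
  rw [h0] at this hH
  nlinarith [sq_nonneg (g r), h.hb]

theorem finite_zeros_Icc (h : IsDampedOrbit a b δ f g d) (h0 : g 0 ≠ 0) (R : ℝ) :
    (Icc 0 R ∩ {r | g r = 0}).Finite := by
  by_contra hinf
  obtain ⟨z, hz, hacc⟩ := Set.Infinite.exists_accPt_of_subset_isCompact hinf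
    (isCompact_Icc (a := 0) (b := R)) inter_subset_left
  have hcl : IsClosed (Icc 0 R ∩ {r | g r = 0}) :=
    (h.cont_g_Icc le_rfl).preimage_isClosed_of_isClosed isClosed_Icc isClosed_singleton
  have hgz : g z = 0 := by
    have : z ∈ closure (Icc 0 R ∩ {r | g r = 0}) := mem_closure_iff_clusterPt.2 hacc.clusterPt
    rw [hcl.closure_eq] at this
    exact this.2
  have hz0 : 0 < z := lt_of_le_of_ne hz.1 (fun h' => h0 (h' ▸ hgz))
  have hne := (h.derivg z hz0).eventually_ne (c := 0) (h.deriv_g_ne_zero hz0.le hgz)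
  rw [accPt_iff_frequently_nhdsNE] at hacc
  obtain ⟨r, hr1, hr2⟩ := (hacc.and_eventually hne).exists
  exact hr2 hr1.2

/-- Once the energy is nonpositive it becomes negative. -/
theorem ham_neg_of_le (h : IsDampedOrbit a b δ f g d) {r₀ : ℝ} (hr₀ : 0 ≤ r₀)
    (hH : Ham a b (f r₀) (g r₀) ≤ 0) {r : ℝ} (hr : r₀ < r) : Ham a b (f r) (g r) < 0 := by
  by_contra hc
  push Not at hc
  have ha := h.a_pos
  have hb := h.hb
  have hzero : ∀ q ∈ Icc r₀ r, Ham a b (f q) (g q) = 0 := fun q hq =>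
    le_antisymm ((h.ham_anti hr₀ hq.1).trans hH) (hc.trans (h.ham_anti (hr₀.trans hq.1) hq.2))
  have hf : ∀ q ∈ Ioo r₀ r, f q = 0 := by
    intro q hq
    have hq0 : 0 < q := hr₀.trans_lt hq.1
    have hev : (fun q => Ham a b (f q) (g q)) =ᶠ[𝓝 q] fun _ => 0 := by
      filter_upwards [Ioo_mem_nhds hq.1 hq.2] with p hp
      exact hzero p (Ioo_subset_Icc_self hp)
    have h1 := (h.ham_deriv hq0).unique ((hasDerivAt_const q (0 : ℝ)).congr_of_eventuallyEq hev)
    have h2 := hzero q (Ioo_subset_Icc_self hq)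
    have hw : 0 < 1 - g q ^ 2 := by have := h.g_lt q hq0.le; linarith
    by_cases hgq : a * g q ^ 2 ≤ 2 * b
    · rw [h.damp_one q hq0.le hgq] at h1
      by_contra hfq
      have : 0 < 2 * 1 / q * f q ^ 2 * (1 - g q ^ 2) := by positivity
      linarith
    · push Not at hgq
      have h3 := two_mul_ham a b (f q) (g q)
      rw [h2] at h3
      have h4 : 0 ≤ f q ^ 2 * (1 - g q ^ 2) := by positivity
      exfalso
      have h5 : 0 < g q ^ 2 := by
        by_contra h6
        push Not at h6
        nlinarith
      nlinarith
  obtain ⟨q, hq⟩ := exists_between hr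
  have hq0 : 0 < q := hr₀.trans_lt hq.1
  have hev : f =ᶠ[𝓝 q] fun _ => 0 := by
    filter_upwards [Ioo_mem_nhds hq.1 hq.2] with p hp
    exact hf p hp
  have h1 := (h.derivf q hq0).unique ((hasDerivAt_const q (0 : ℝ)).congr_of_eventuallyEq hev)
  have h2 := hzero q (Ioo_subset_Icc_self hq)
  have hgne := h.ne_zero q hq0.le (hf q hq)
  rw [hf q hq] at h1 h2
  have h3 : b - a * g q ^ 2 = 0 := by
    have : g q * (b - a * g q ^ 2) = 0 := by linarith
    exact (mul_eq_zero.1 this).resolve_left hgne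
  have hpos : 0 < g q ^ 2 := by positivity
  unfold Ham at h2
  nlinarith

theorem ne_zero_of_ham_neg (h : IsDampedOrbit a b δ f g d) {r : ℝ} (hr : 0 ≤ r)
    (hH : Ham a b (f r) (g r) < 0) : g r ≠ 0 := fun h0 =>
  absurd (h.ham_pos_of_zero hr h0) (not_lt.2 hH.le)

/-- The energy of a monotone orbit converging to the origin is `o(1/r)`. -/
theorem eventually_mul_ham_le (h : IsDampedOrbit a b δ f g d) (hflim : Tendsto f atTop (𝓝 0))
    (hglim : Tendsto g atTop (𝓝 0)) {R : ℝ} (hfpos : ∀ r, R ≤ r → 0 < f r) (ε : ℝ) (hε : 0 < ε) :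
    ∀ᶠ r in atTop, r * Ham a b (f r) (g r) ≤ ε := by
  have hHlim : Tendsto (fun r => Ham a b (f r) (g r)) atTop (𝓝 0) := by
    have h1 := ((continuous_ham a b).tendsto (0, 0)).comp (hflim.prodMk_nhds hglim)
    have h2 : Ham a b 0 0 = 0 := by unfold Ham; ring
    rwa [h2] at h1
  obtain ⟨S, hS⟩ := eventually_atTop.1 (hflim.eventually_lt_const (half_pos hε))
  filter_upwards [eventually_ge_atTop (max (max R 1) S)] with r hr
  have hrR : R ≤ r := ((le_max_left _ _).trans (le_max_left _ _)).trans hr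
  have hr0 : 0 < r :=
      one_pos.trans_le (((le_max_right _ _).trans (le_max_left _ _)).trans hr)
  have hlim : Tendsto (fun t => Ham a b (f t) (g t) + ε / r * g t) atTop (𝓝 0) := by
    simpa using hHlim.add (hglim.const_mul (ε / r))
  have h1 : Ham a b (f r) (g r) + ε / r * g r ≤ 0 := ge_of_tendsto hlim (by
    filter_upwards [eventually_ge_atTop r] with t ht
    refine le_of_hasDerivAt_nonneg (u := fun t => Ham a b (f t) (g t) + ε / r * g t) ht
      ((h.cont_ham_Icc hr0.le).add (continuousOn_const.mul (h.cont_g_Icc hr0.le))) (fun q hq => ?_)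
    have hq0 : 0 < q := hr0.trans hq.1
    refine ⟨_, (h.ham_deriv hq0).add ((h.derivg q hq0).const_mul (ε / r)), ?_⟩
    have h2 := hfpos q (hrR.trans hq.1.le)
    have h3 : 0 < 1 - g q ^ 2 := sub_pos.2 (h.g_lt q hq0.le)
    have h4 := hS q (((le_max_right _ _).trans hr).trans hq.1.le)
    have h5 : 2 * d q / q * f q ≤ ε / r := by
      have h6 := h.damp_mem q
      calc 2 * d q / q * f q ≤ 2 * 1 / q * (ε / 2) := by gcongr; exact h6.2
        _ = ε / q := by ring
        _ ≤ ε / r := by gcongr; exact hq.1.le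
    have h7 : 0 ≤ (ε / r - 2 * d q / q * f q) * (f q * (1 - g q ^ 2)) :=
      mul_nonneg (by linarith) (mul_pos h2 h3).le
    linarith)
  have h2 := (abs_lt.1 (h.abs_g_lt hr0.le)).1
  have h3 : r * (Ham a b (f r) (g r) + ε / r * g r) = r * Ham a b (f r) (g r) + ε * g r := by
    field_simp
  have h4 : r * (Ham a b (f r) (g r) + ε / r * g r) ≤ 0 :=
    mul_nonpos_of_nonneg_of_nonpos hr0.le h1
  nlinarith

/-- Orbits whose energy stays positive converge to the origin, monotonically in `g`. -/
theorem tendsto_of_ham_pos (h : IsDampedOrbit a b δ f g d)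
    (hH : ∀ r, 0 ≤ r → 0 < Ham a b (f r) (g r)) :
    Tendsto f atTop (𝓝 0) ∧ Tendsto g atTop (𝓝 0) ∧ (∃ R, 0 < R ∧ ∀ r, R ≤ r → g r ≠ 0) ∧
      ∀ ε, 0 < ε → ∀ᶠ r in atTop, r * Ham a b (f r) (g r) ≤ ε := by
  have ha := h.a_pos
  have hb := h.hb
  obtain ⟨γ, hγ, hγ2⟩ : ∃ γ : ℝ, 0 < γ ∧ a * γ ^ 2 = b := by
    refine ⟨√(b / a), by positivity, ?_⟩
    rw [Real.sq_sqrt (by positivity)]; field_simp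
  obtain ⟨R, hR, hgR⟩ := h.eventually_abs_g_lt hγ hγ2 hH
  have hfne : ∀ r, R ≤ r → f r ≠ 0 := fun r hr =>
    h.f_ne_zero_of_small hγ2 (hgR r hr).le (hH r (hR.le.trans hr))
  wlog hf : 0 < f R generalizing f g
  · have hf' : 0 < -f R := by
      have := lt_of_le_of_ne (not_lt.1 hf) (hfne R le_rfl)
      linarith
    obtain ⟨h1, h2, ⟨R', hR', h3⟩, h4⟩ := this h.neg (by simpa only [ham_neg] using hH)
      (by simpa only [abs_neg] using hgR) (fun r hr => neg_ne_zero.2 (hfne r hr)) hf'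
    refine ⟨by simpa using h1.neg, by simpa using h2.neg, ⟨R', hR', fun r hr h0 => h3 r hr
      (by rw [h0, neg_zero])⟩, by simpa only [ham_neg] using h4⟩
  have hfpos : ∀ r, R ≤ r → 0 < f r := fun r hr =>
    pos_of_ne_zero_on_Icc (h.cont_f_Icc hR.le) (fun q hq => hfne q hq.1)
      (left_mem_Icc.2 hr) hf r (right_mem_Icc.2 hr)
  have hw : ∀ r, R ≤ r → 0 < 1 - g r ^ 2 := fun r hr => by
    have := h.g_lt r (hR.le.trans hr); linarith
  have hgsq : ∀ r, R ≤ r → a * g r ^ 2 ≤ b := fun r hr => by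
    rw [← hγ2, ← sq_abs (g r)]
    have := hgR r hr
    gcongr
  have hgmono : ∀ s t, R ≤ s → s ≤ t → g s ≤ g t := fun s t hs hst =>
    le_of_hasDerivAt_nonneg hst (h.cont_g_Icc (hR.le.trans hs)) (fun r hr => by
      have hr' : R ≤ r := hs.trans hr.1.le
      exact ⟨_, h.derivg r (hR.trans_le hr'), (mul_pos (hfpos r hr') (hw r hr')).le⟩)
  obtain ⟨L, hL⟩ := exists_tendsto_of_antitoneOn (u := fun r => Ham a b (f r) (g r)) (R := R)
    (m := 0) (fun s hs t _ hst => h.ham_anti (hR.le.trans hs) hst)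
    (fun r hr => (hH r (hR.le.trans hr)).le)
  obtain ⟨q, hq⟩ := exists_tendsto_of_antitoneOn (u := fun r => -g r) (R := R)
    (m := -1) (fun s hs t _ hst => neg_le_neg (hgmono s t hs hst))
    (fun r hr => neg_le_neg (abs_lt.1 (h.abs_g_lt (hR.le.trans hr))).2.le)
  have hg' : Tendsto g atTop (𝓝 (-q)) := by simpa using hq.neg
  have hdg : Tendsto (fun r => f r * (1 - g r ^ 2)) atTop
      (𝓝 (√((2 * L - a / 2 * (-q) ^ 4 + b * (-q) ^ 2) * (1 - (-q) ^ 2)))) := by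
    have h1 : Tendsto (fun r => √((2 * Ham a b (f r) (g r) - a / 2 * g r ^ 4 + b * g r ^ 2)
        * (1 - g r ^ 2))) atTop
        (𝓝 (√((2 * L - a / 2 * (-q) ^ 4 + b * (-q) ^ 2) * (1 - (-q) ^ 2)))) :=
      ((((hL.const_mul 2).sub ((hg'.pow 4).const_mul _)).add ((hg'.pow 2).const_mul _)).mul
        ((hg'.pow 2).const_sub 1)).sqrt
    refine h1.congr' ?_
    filter_upwards [eventually_ge_atTop R] with r hr
    rw [← two_mul_ham, Real.sqrt_eq_iff_mul_self_eq_of_pos (mul_pos (hfpos r hr) (hw r hr))]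
    ring
  set p := √((2 * L - a / 2 * (-q) ^ 4 + b * (-q) ^ 2) * (1 - (-q) ^ 2)) with hp
  have hp0 : p = 0 := by
    by_contra hne
    have hpos : 0 < p := lt_of_le_of_ne (Real.sqrt_nonneg _) (Ne.symm hne)
    obtain ⟨S, hS⟩ := eventually_atTop.1 (hdg.eventually_const_lt (half_lt_self hpos))
    have hS1 : R ≤ max R S := le_max_left _ _
    have h1 := mul_sub_le_of_hasDerivAt (u := g) (s := max R S) (t := max R S + 6 / p) (c := p / 2)
      (by have : 0 < 6 / p := by positivity
          linarith) (h.cont_g_Icc (hR.le.trans hS1)) (fun r hr =>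
        ⟨_, h.derivg r (hR.trans_le (hS1.trans hr.1.le)),
          (hS r ((le_max_right _ _).trans hr.1.le)).le⟩)
    have h2 := abs_lt.1 (h.abs_g_lt (hR.le.trans hS1))
    have h3 := abs_lt.1 (h.abs_g_lt (r := max R S + 6 / p) (by positivity))
    have h4 : p / 2 * (max R S + 6 / p - max R S) = 3 := by field_simp; ring
    linarith
  rw [hp0] at hdg
  have hflim : Tendsto f atTop (𝓝 0) := by
    refine squeeze_zero' (t₀ := atTop) (g := fun r => 2 * (f r * (1 - g r ^ 2))) ?_ ?_ ?_
    · filter_upwards [eventually_ge_atTop R] with r hr using (hfpos r hr).le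
    · filter_upwards [eventually_ge_atTop R] with r hr
      have h1 := hfpos r hr
      have h2 : g r ^ 2 ≤ 1 / 2 := by
        have : a * g r ^ 2 ≤ a * (1 / 2) := by linarith [h.hab, hgsq r hr]
        exact le_of_mul_le_mul_left this ha
      nlinarith
    · simpa using hdg.const_mul 2
  have hglim : Tendsto g atTop (𝓝 0) := by
    have h1 : Tendsto (fun r => g r ^ 2) atTop (𝓝 0) := by
      refine squeeze_zero' (t₀ := atTop) (g := fun r => 2 / b * f r ^ 2) ?_ ?_ ?_
      · exact Eventually.of_forall fun r => sq_nonneg _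
      · filter_upwards [eventually_ge_atTop R] with r hr
        have h1 := le_f_sq_mul (f := f) (hgsq r hr)
        have h2 := hH r (hR.le.trans hr)
        rw [div_mul_eq_mul_div, le_div_iff₀ hb]
        nlinarith [sq_nonneg (f r), sq_nonneg (g r), mul_nonneg (sq_nonneg (f r)) (sq_nonneg (g r))]
      · simpa using (hflim.pow 2).const_mul (2 / b)
    have h2 : (-q) ^ 2 = 0 := tendsto_nhds_unique (hg'.pow 2) h1
    rw [pow_eq_zero_iff two_ne_zero] at h2
    rwa [h2] at hg'
  refine ⟨hflim, hglim, ⟨R, hR, fun r hr h0 => ?_⟩, fun ε hε => ?_⟩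
  · obtain ⟨e, he, h1⟩ := eventually_mul_pos_of_hasDerivAt (h.derivg r (hR.trans_le hr))
      (mul_pos (hfpos r hr) (hw r hr)).ne' h0
    have h2 := h1 (r + e / 2) (by rw [add_sub_cancel_left, abs_pos]; positivity)
      (by rw [add_sub_cancel_left, abs_of_pos (by positivity)]; linarith)
    rw [add_sub_cancel_left] at h2
    have h3 : g (r + e / 2) ≤ 0 := ge_of_tendsto hglim (by
      filter_upwards [eventually_ge_atTop (r + e / 2)] with t ht
      exact hgmono _ _ (by linarith) ht)
    have h4 := mul_pos (hfpos r hr) (hw r hr)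
    have h5 : e / 2 * g (r + e / 2) ≤ 0 := mul_nonpos_of_nonneg_of_nonpos (by positivity) h3
    nlinarith
  · exact h.eventually_mul_ham_le hflim hglim hfpos ε hε

end IsDampedOrbit

theorem nonneg_or_nonpos_of_ne_zero {u : ℝ → ℝ} {s t : ℝ} (hc : ContinuousOn u (Icc s t))
    (hne : ∀ r ∈ Ioo s t, u r ≠ 0) :
    (∀ r ∈ Icc s t, 0 ≤ u r) ∨ ∀ r ∈ Icc s t, u r ≤ 0 := by
  by_contra hcon
  push Not at hcon
  obtain ⟨⟨p, hp, hup⟩, q, hq, huq⟩ := hcon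
  obtain ⟨z, hz, huz⟩ := intermediate_value_uIcc (hc.mono (uIcc_subset_Icc hp hq))
    (mem_uIcc.2 (Or.inl ⟨hup.le, huq.le⟩))
  have hzp : z ≠ p := fun h => by rw [h] at huz; exact hup.ne huz
  have hzq : z ≠ q := fun h => by rw [h] at huz; exact huq.ne' huz
  rcases mem_uIcc.1 hz with ⟨h1, h2⟩ | ⟨h1, h2⟩
  · exact hne z ⟨hp.1.trans_lt (lt_of_le_of_ne h1 hzp.symm),
      (lt_of_le_of_ne h2 hzq).trans_le hq.2⟩ huz
  · exact hne z ⟨hq.1.trans_lt (lt_of_le_of_ne h1 hzq.symm),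
      (lt_of_le_of_ne h2 hzp).trans_le hp.2⟩ huz

/-- An orbit with little energy left cannot vanish twice, uniformly in the orbit. -/
theorem exists_zero_unique_of_ham_lt {a b δ : ℝ} (hb : 0 < b) (hab : 2 * b < a) (hδ : 0 < δ) :
    ∃ κ R : ℝ, 0 < κ ∧ 0 < R ∧ ∀ f g d : ℝ → ℝ, IsDampedOrbit a b δ f g d →
      ∀ r, R ≤ r → Ham a b (f r) (g r) < κ / r →
        ∀ s t, r ≤ s → s < t → g s = 0 → g t ≠ 0 := by
  have ha : 0 < a := by linarith
  obtain ⟨γ, hγ, hγ2⟩ : ∃ γ : ℝ, 0 < γ ∧ a * γ ^ 2 = b := by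
    refine ⟨√(b / a), by positivity, ?_⟩
    rw [Real.sq_sqrt (by positivity)]; field_simp
  obtain ⟨c, T, R₁, hc, hT, hR₁, hloss⟩ := IsDampedOrbit.exists_excursion_loss hγ hγ2 hδ hb hab
  obtain ⟨C, R₂, -, -, hpass⟩ := IsDampedOrbit.exists_passage_bound (δ := δ) hγ2 hb hc hT
  refine ⟨c / 2, max R₁ R₂, by positivity, lt_max_of_lt_left hR₁,
    fun f g d h r hr hH s t hrs hst hgs hgt => ?_⟩
  have hr0 : 0 < r := (lt_max_of_lt_left hR₁).trans_le hr
  have ht0 : 0 < t := hr0.trans_le (hrs.trans hst.le)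
  have hHt := h.ham_pos_of_zero ht0.le hgt
  by_cases hsmall : ∀ q ∈ Icc r t, |g q| < γ
  · obtain ⟨q, hq, hq'⟩ := exists_hasDerivAt_eq_zero hst (h.cont_g_Icc (hr0.le.trans hrs))
      (hgs.trans hgt.symm) (fun q hq => h.derivg q (hr0.trans (hrs.trans_lt hq.1)))
    have hq0 : 0 < q := hr0.trans (hrs.trans_lt hq.1)
    have hw : 1 - g q ^ 2 ≠ 0 := (sub_pos.2 (h.g_lt q hq0.le)).ne'
    exact h.f_ne_zero_of_small hγ2 (hsmall q ⟨hrs.trans hq.1.le, hq.2.le⟩).le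
      (hHt.trans_le (h.ham_anti hq0.le hq.2.le)) ((mul_eq_zero.1 hq').resolve_right hw)
  · push Not at hsmall
    obtain ⟨q, hq, hγq⟩ := hsmall
    obtain ⟨p, hp, hpC, hpmin⟩ := exists_first_mem hq.1 (h.cont_g_Icc hr0.le).abs
      (isClosed_Ici (a := γ)) hγq
    have h1 := (hloss f g d h p ((le_max_left _ _).trans (hr.trans hp.1)) hpC).2 t
      (hp.2.trans hq.2) hgt hHt
    have h2 := (hpass f g d h r p ((le_max_right _ _).trans hr) hp.1
      (fun q hq => not_le.1 (hpmin q hq)) h1).1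
    have h3 := h.ham_anti hr0.le hp.1
    have h4 : c / 2 / r ≤ c / (p + T) := by
      rw [div_div]
      have : 0 < p + T := by linarith [hp.1]
      gcongr
    linarith

namespace IsDampedOrbit

variable {a b δ : ℝ} {f g d : ℝ → ℝ}

theorem ham_pos_or_neg (h : IsDampedOrbit a b δ f g d) :
    (∀ r, 0 ≤ r → 0 < Ham a b (f r) (g r)) ∨
      ∃ R, 0 < R ∧ ∀ r, R ≤ r → Ham a b (f r) (g r) < 0 := by
  refine or_iff_not_imp_left.2 fun hcon => ?_
  push Not at hcon
  obtain ⟨r, hr, hH⟩ := hcon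
  exact ⟨r + 1, by linarith, fun q hq => h.ham_neg_of_le hr hH (by linarith)⟩

theorem finite_zeros (h : IsDampedOrbit a b δ f g d) (h0 : g 0 ≠ 0) :
    {r | 0 < r ∧ g r = 0}.Finite := by
  obtain ⟨R, hR⟩ : ∃ R, ∀ r, R ≤ r → 0 ≤ r → g r ≠ 0 := by
    rcases h.ham_pos_or_neg with hH | ⟨R, hR, hH⟩
    · obtain ⟨-, -, ⟨R, -, hR⟩, -⟩ := h.tendsto_of_ham_pos hH
      exact ⟨R, fun r hr _ => hR r hr⟩
    · exact ⟨R, fun r hr hr0 => h.ne_zero_of_ham_neg hr0 (hH r hr)⟩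
  refine (h.finite_zeros_Icc h0 R).subset fun r hr => ⟨⟨hr.1.le, ?_⟩, hr.2⟩
  by_contra hc
  exact hR r (not_le.1 hc).le hr.1.le hr.2

theorem changesSignExactly (h : IsDampedOrbit a b δ f g d) (h0 : g 0 ≠ 0) :
    ChangesSignExactly g (Ioi 0) {r | 0 < r ∧ g r = 0}.ncard := by
  have : {r | ChangesSignAt g (Ioi 0) r} = {r | 0 < r ∧ g r = 0} :=
    Set.ext fun r => h.changesSignAt_iff
  unfold ChangesSignExactly
  rw [this]
  exact ⟨h.finite_zeros h0, rfl⟩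

/-- While `g ≥ 0` and the energy is positive, `f` cannot become positive again. -/
theorem f_nonpos_of_nonneg (h : IsDampedOrbit a b δ f g d) {s t : ℝ} (hs : 0 < s) (hst : s ≤ t)
    (hg : ∀ r ∈ Icc s t, 0 ≤ g r) (hH : ∀ r ∈ Icc s t, 0 < Ham a b (f r) (g r))
    (hf : f s ≤ 0) : f t ≤ 0 := by
  by_contra hft
  push Not at hft
  obtain ⟨q, hq, hqC, hqmax⟩ := exists_last_mem hst (h.cont_f_Icc hs.le) (isClosed_Iic (a := 0)) hf
  have hpos : ∀ r ∈ Ioc q t, 0 < f r := fun r hr => not_le.1 (hqmax r hr)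
  have hqt : q < t := lt_of_le_of_ne hq.2 (fun h' => absurd hqC (by rw [h']; exact not_le.2 hft))
  have hq0 : 0 < q := hs.trans_le hq.1
  obtain ⟨z, hz, hfz⟩ := intermediate_value_Icc hqt.le (h.cont_f_Icc hq0.le) ⟨hqC, hft.le⟩
  have hzq : z = q := by
    by_contra hne
    exact (hpos z ⟨lt_of_le_of_ne hz.1 (Ne.symm hne), hz.2⟩).ne' hfz
  rw [hzq] at hfz
  have h1 := hH q hq
  have h2 := h.derivf q hq0
  rw [hfz] at h2
  unfold Ham at h1
  rw [hfz] at h1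
  have hgq : 0 < g q := lt_of_le_of_ne (hg q hq) (h.ne_zero q hq0.le hfz).symm
  have hgq2 : 0 < g q ^ 2 := by positivity
  have h3 : 2 * b < a * g q ^ 2 := by
    by_contra hc
    push Not at hc
    nlinarith
  have h4 : g q * (0 ^ 2 - a * g q ^ 2 + b) - 2 * d q / q * 0 < 0 := by
    have : g q * (a * g q ^ 2 - b) > 0 := mul_pos hgq (by linarith [h.hb])
    linarith
  obtain ⟨e, he, h5⟩ := eventually_mul_pos_of_hasDerivAt h2 h4.ne hfz
  have he1 : 0 < min (e / 2) (t - q) := lt_min (by positivity) (by linarith)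
  have h6 := h5 (q + min (e / 2) (t - q)) (by rw [add_sub_cancel_left, abs_of_pos he1]; exact he1)
    (by rw [add_sub_cancel_left, abs_of_pos he1]; linarith [min_le_left (e / 2) (t - q)])
  rw [add_sub_cancel_left] at h6
  have h7 := hpos (q + min (e / 2) (t - q))
    ⟨by linarith, by linarith [min_le_right (e / 2) (t - q)]⟩
  exact absurd h6 (not_lt.2 (mul_nonpos_of_nonneg_of_nonpos (mul_pos he1 h7).le h4.le))

theorem ham_loss_of_sign (h : IsDampedOrbit a b δ f g d) {s t : ℝ} (hs : 0 < s) (hst : s ≤ t)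
    (hf : ∀ r ∈ Ioo s t, 0 ≤ f r) :
    Ham a b (f s) (g s) - Ham a b (f t) (g t) ≤ 2 * √(a - b) / s * (g t - g s) := by
  have h1 := le_of_hasDerivAt_nonneg
    (u := fun r => Ham a b (f r) (g r) + 2 * √(a - b) / s * g r) hst
    ((h.cont_ham_Icc hs.le).add (continuousOn_const.mul (h.cont_g_Icc hs.le))) (fun r hr => by
      have hr0 : 0 < r := hs.trans hr.1
      refine ⟨_, (h.ham_deriv hr0).add ((h.derivg r hr0).const_mul (2 * √(a - b) / s)), ?_⟩
      have h2 := hf r hr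
      have h3 := sub_pos.2 (h.g_lt r hr0.le)
      have h4 : 2 * d r / r * f r ≤ 2 * √(a - b) / s := by
        have h5 := h.damp_mem r
        calc 2 * d r / r * f r ≤ 2 * 1 / s * √(a - b) := by
              gcongr
              · exact h5.2
              · exact hr.1.le
              · exact (le_abs_self _).trans (h.abs_f_lt hr0.le).le
          _ = _ := by ring
      have h5 : 0 ≤ (2 * √(a - b) / s - 2 * d r / r * f r) * (f r * (1 - g r ^ 2)) :=
        mul_nonneg (by linarith) (mul_nonneg h2 h3.le)
      linarith)
  linarith

theorem ham_loss_of_nonneg (h : IsDampedOrbit a b δ f g d) {s t : ℝ} (hs : 0 < s) (hst : s ≤ t)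
    (hg : ∀ r ∈ Icc s t, 0 ≤ g r) (hH : ∀ r ∈ Icc s t, 0 < Ham a b (f r) (g r)) :
    Ham a b (f s) (g s) - Ham a b (f t) (g t) ≤ 4 * √(a - b) / s := by
  have hM : 0 ≤ 2 * √(a - b) / s := by positivity
  have e4 : 4 * √(a - b) / s = 2 * √(a - b) / s + 2 * √(a - b) / s := by ring
  have hg1 : ∀ r ∈ Icc s t, g r ≤ 1 := fun r hr =>
    (abs_lt.1 (h.abs_g_lt (hs.le.trans hr.1))).2.le
  by_cases hf : ∀ r ∈ Icc s t, 0 < f r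
  · have h1 := h.ham_loss_of_sign hs hst fun r hr => (hf r (Ioo_subset_Icc_self hr)).le
    have h2 := hg s (left_mem_Icc.2 hst)
    have h3 := hg1 t (right_mem_Icc.2 hst)
    nlinarith
  · push Not at hf
    obtain ⟨q, hq, hfq⟩ := hf
    obtain ⟨p, hp, hpC, hpmin⟩ := exists_first_mem hq.1 (h.cont_f_Icc hs.le)
      (isClosed_Iic (a := 0)) hfq
    have hpt : p ≤ t := hp.2.trans hq.2
    have hp0 : 0 < p := hs.trans_le hp.1
    have h1 := h.ham_loss_of_sign hs hp.1 fun r hr =>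
      (not_le.1 (hpmin r (Ioo_subset_Ico_self hr))).le
    have h2 := h.neg.ham_loss_of_sign hp0 hpt fun r hr => by
      have hsub : Icc p r ⊆ Icc s t := Icc_subset_Icc hp.1 hr.2.le
      exact neg_nonneg.2 (h.f_nonpos_of_nonneg hp0 hr.1.le (fun q hq => hg q (hsub hq))
        (fun q hq => hH q (hsub hq)) hpC)
    simp only [ham_neg] at h2
    have h3 := hg s (left_mem_Icc.2 hst)
    have h4 := hg1 p ⟨hp.1, hpt⟩
    have h5 := hg t (right_mem_Icc.2 hst)
    have h6 : 2 * √(a - b) / p * (-g t - -g p) ≤ 2 * √(a - b) / s * 1 :=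
      calc 2 * √(a - b) / p * (-g t - -g p) ≤ 2 * √(a - b) / p * 1 := by
            gcongr; linarith
        _ ≤ _ := by gcongr; exact hp.1
    nlinarith

/-- Between consecutive zeros of `g` the energy drops by at most `O(1/r)`. -/
theorem ham_loss_of_ne_zero (h : IsDampedOrbit a b δ f g d) {s t : ℝ} (hs : 0 < s) (hst : s ≤ t)
    (hg : ∀ r ∈ Ioo s t, g r ≠ 0) (hH : ∀ r ∈ Icc s t, 0 < Ham a b (f r) (g r)) :
    Ham a b (f s) (g s) - Ham a b (f t) (g t) ≤ 4 * √(a - b) / s := by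
  rcases nonneg_or_nonpos_of_ne_zero (h.cont_g_Icc hs.le) hg with hg | hg
  · exact h.ham_loss_of_nonneg hs hst hg hH
  · have := h.neg.ham_loss_of_nonneg hs hst (fun r hr => neg_nonneg.2 (hg r hr))
      (by simpa only [ham_neg] using hH)
    simpa only [ham_neg] using this

theorem ham_loss_le_card (h : IsDampedOrbit a b δ f g d) (h0 : g 0 ≠ 0) {ρ : ℝ} (hρ : 0 < ρ)
    (n : ℕ) : ∀ s t, ρ ≤ s → s ≤ t → (∀ r ∈ Icc s t, 0 < Ham a b (f r) (g r)) →
      {r | r ∈ Ioc s t ∧ g r = 0}.ncard ≤ n →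
      Ham a b (f s) (g s) - Ham a b (f t) (g t) ≤ (n + 1) * (4 * √(a - b) / ρ) := by
  induction n with
  | zero =>
    intro s t hs hst hH hn
    have hs0 := hρ.trans_le hs
    have hfin : {r | r ∈ Ioc s t ∧ g r = 0}.Finite :=
      (h.finite_zeros h0).subset fun r hr => ⟨hs0.trans hr.1.1, hr.2⟩
    have hempty := (Set.ncard_eq_zero hfin).1 (Nat.le_zero.1 hn)
    refine (h.ham_loss_of_ne_zero hs0 hst (fun r hr hgr => ?_) hH).trans ?_
    · exact (Set.eq_empty_iff_forall_notMem.1 hempty) r ⟨Ioo_subset_Ioc_self hr, hgr⟩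
    · rw [Nat.cast_zero, zero_add, one_mul]
      gcongr
  | succ n ih =>
    intro s t hs hst hH hn
    have hs0 := hρ.trans_le hs
    have hfin : {r | r ∈ Ioc s t ∧ g r = 0}.Finite :=
      (h.finite_zeros h0).subset fun r hr => ⟨hs0.trans hr.1.1, hr.2⟩
    have hM : 4 * √(a - b) / s ≤ 4 * √(a - b) / ρ := by gcongr
    have hM0 : 0 ≤ 4 * √(a - b) / ρ := by positivity
    push_cast
    rcases Set.eq_empty_or_nonempty {r | r ∈ Ioc s t ∧ g r = 0} with hemp | hne
    · have := h.ham_loss_of_ne_zero hs0 hst (fun r hr hgr =>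
        (Set.eq_empty_iff_forall_notMem.1 hemp) r ⟨Ioo_subset_Ioc_self hr, hgr⟩) hH
      nlinarith [n.cast_nonneg (α := ℝ)]
    · obtain ⟨z, hz, hmin⟩ := Set.exists_min_image _ id hfin hne
      have hsub : {r | r ∈ Ioc z t ∧ g r = 0} ⊆ {r | r ∈ Ioc s t ∧ g r = 0} \ {z} :=
        fun r hr => ⟨⟨⟨hz.1.1.trans hr.1.1, hr.1.2⟩, hr.2⟩, hr.1.1.ne'⟩
      have hcard := Set.ncard_le_ncard hsub (hfin.subset sdiff_subset)
      have hcard' := Set.ncard_sdiff_singleton_add_one hz hfin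
      have h1 := h.ham_loss_of_ne_zero hs0 hz.1.1.le (fun r hr hgr =>
        absurd (hmin r ⟨⟨hr.1, hr.2.le.trans hz.1.2⟩, hgr⟩) (not_le.2 hr.2))
        (fun r hr => hH r ⟨hr.1, hr.2.trans hz.1.2⟩)
      have h2 := ih z t (hs.trans hz.1.1.le) hz.1.2
        (fun r hr => hH r ⟨hz.1.1.le.trans hr.1, hr.2⟩) (by omega)
      linarith

/-- An orbit which is still energetic at a late time has many zeros. -/
theorem lt_ncard_zeros (h : IsDampedOrbit a b δ f g d) (h0 : g 0 ≠ 0) {ρ : ℝ} (hρ : 0 < ρ) {n : ℕ}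
    (hH : (n + 1) * (4 * √(a - b) / ρ) < Ham a b (f ρ) (g ρ)) :
    n < {r | 0 < r ∧ g r = 0}.ncard := by
  by_contra hcon
  push Not at hcon
  obtain ⟨e, he, heH⟩ := exists_between (sub_pos.2 hH)
  have hM0 : 0 ≤ (n + 1) * (4 * √(a - b) / ρ) := by positivity
  obtain ⟨T, hT, hHT⟩ : ∃ T, ρ ≤ T ∧ Ham a b (f T) (g T) ≤ e := by
    rcases h.ham_pos_or_neg with hP | ⟨R, -, hN⟩
    · obtain ⟨-, -, -, hlim⟩ := h.tendsto_of_ham_pos hP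
      obtain ⟨T, hT1, hT2, hT3⟩ := ((hlim e he).and ((eventually_ge_atTop ρ).and
        (eventually_ge_atTop 1))).exists
      have := hP T (by linarith)
      exact ⟨T, hT2, by nlinarith⟩
    · exact ⟨max ρ R, le_max_left _ _, (hN _ (le_max_right _ _)).le.trans he.le⟩
  obtain ⟨t, ht, hHt⟩ := intermediate_value_Icc' hT (h.cont_ham_Icc hρ.le)
    ⟨hHT, by linarith⟩
  simp only at hHt
  have hsub : {r | r ∈ Ioc ρ t ∧ g r = 0} ⊆ {r | 0 < r ∧ g r = 0} :=
    fun r hr => ⟨hρ.trans hr.1.1, hr.2⟩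
  have := h.ham_loss_le_card h0 hρ n ρ t le_rfl ht.1 (fun r hr => by
    have := h.ham_anti (hρ.le.trans hr.1) hr.2
    linarith) ((Set.ncard_le_ncard hsub (h.finite_zeros h0)).trans hcon)
  linarith

end IsDampedOrbit

theorem four_mul_ham_gap (a b f g : ℝ) :
    (1 - g ^ 2) * (a * g ^ 2 + a - 2 * b - 2 * f ^ 2) = a - 2 * b - 4 * Ham a b f g := by
  unfold Ham; ring

namespace IsRegSolOn

variable {a b η x : ℝ} {φ : ℝ → ℝ → ℝ} {f g : ℝ → ℝ}

theorem g_sq_lt (h : IsRegSolOn a b φ x f g (Ici 0)) (hx : x ^ 2 < 1) {r : ℝ} (hr : 0 ≤ r) :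
    g r ^ 2 < 1 := by
  obtain ⟨-, hg0, hcf, hcg, hd⟩ := h
  have hcw : ∀ t, ContinuousOn (fun r => 1 - g r ^ 2) (Icc 0 t) := fun t =>
    continuousOn_const.sub ((hcg.mono Icc_subset_Ici_self).pow 2)
  have hne : ∀ t, 0 ≤ t → 1 - g t ^ 2 ≠ 0 := by
    intro t ht h0
    obtain ⟨B, hB⟩ := (isCompact_Icc (a := 0) (b := t)).exists_bound_of_continuousOn
      ((hcf.mul hcg).mono Icc_subset_Ici_self)
    have h1 := exp_mul_le_of_hasDerivAt (u := fun r => (1 - g r ^ 2) ^ 2) (K := -(4 * B)) ht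
      ((hcw t).pow 2) (fun r hr => by
        refine ⟨_, (((hd r hr.1.le hr.1).2.pow 2).const_sub 1).pow 2, ?_⟩
        have h2 := (abs_le.1 (hB r (Ioo_subset_Icc_self hr))).2
        simp only [Pi.mul_apply] at h2
        have h3 := mul_nonneg (sub_nonneg.2 h2) (sq_nonneg (1 - g r ^ 2))
        push_cast
        simp only [Pi.pow_apply]
        linarith)
    have h2 : 0 < 1 - x ^ 2 := by linarith
    have h3 : 0 < exp (-(4 * B) * (t - 0)) * (1 - x ^ 2) ^ 2 := by positivity
    simp only [h0, hg0] at h1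
    linarith
  have := pos_of_ne_zero_on_Icc (hcw r) (fun q hq => hne q hq.1) (left_mem_Icc.2 hr)
    (by rw [hg0]; linarith) r (right_mem_Icc.2 hr)
  linarith

theorem ham_le (h : IsRegSolOn a b φ x f g (Ici 0)) (hφ : IsCutoff a b η φ) (hx : x ^ 2 < 1)
    {r : ℝ} (hr : 0 ≤ r) : Ham a b (f r) (g r) ≤ Ham a b 0 x := by
  have hg := fun r hr => h.g_sq_lt hx (r := r) hr
  obtain ⟨hf0, hg0, hcf, hcg, hd⟩ := h
  have := le_of_hasDerivAt_nonneg (u := fun r => -Ham a b (f r) (g r)) hr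
    ((continuousOn_ham hcf hcg).mono Icc_subset_Ici_self).neg (fun q hq => by
      obtain ⟨h1, h2⟩ := hd q hq.1.le hq.1
      refine ⟨_, (hasDerivAt_ham h1 h2).neg, ?_⟩
      have h3 := sub_pos.2 (hg q hq.1.le)
      have h4 := (hφ.1 (f q) (g q)).1
      have h5 := hq.1
      have : 0 ≤ 2 * φ (f q) (g q) / q * f q ^ 2 * (1 - g q ^ 2) := by positivity
      linarith)
  simp only [hf0, hg0] at this
  linarith

/-- The cutoff is inactive as long as `f² ≤ a / 2`. -/
theorem _root_.IsCutoff.eq_one (hφ : IsCutoff a b η φ) (hη : η ∈ Ioo 0 (√(a - b) - √(a / 2)))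
    {u v : ℝ} (hu : u ^ 2 ≤ a / 2) : φ u v = 1 := by
  have h1 : |u| ≤ √(a / 2) := Real.abs_le_sqrt hu
  exact hφ.2.2.2.2 u v (by linarith [hη.2])

theorem isDampedOrbit {xbar : ℝ} (h : IsRegSolOn a b φ x f g (Ici 0)) (hb : 0 < b)
    (hab : 2 * b < a) (hη : η ∈ Ioo 0 (√(a - b) - √(a / 2))) (hφ : IsCutoff a b η φ)
    (hx : 0 < x) (hxx : x ≤ xbar) (hx1 : xbar < 1) :
    IsDampedOrbit a b ((1 - xbar ^ 2) * (a - 2 * b) / 4) f g fun r => φ (f r) (g r) := by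
  have ha : 0 < a := by linarith
  have hx2 : x ^ 2 ≤ xbar ^ 2 := by gcongr
  have hxb : xbar ^ 2 < 1 := by nlinarith
  have hx' : x ^ 2 < 1 := by linarith
  have hδ : 0 < (1 - xbar ^ 2) * (a - 2 * b) / 4 := by
    have : 0 < (1 - xbar ^ 2) * (a - 2 * b) := mul_pos (by linarith) (by linarith)
    linarith
  have hg := fun r hr => h.g_sq_lt hx' (r := r) hr
  have hgap : ∀ r, 0 ≤ r → 4 * ((1 - xbar ^ 2) * (a - 2 * b) / 4) ≤
      (1 - g r ^ 2) * (a * g r ^ 2 + a - 2 * b - 2 * f r ^ 2) := by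
    intro r hr
    have h1 := h.ham_le hφ hx' hr
    rw [four_mul_ham_gap]
    have h2 := four_mul_ham_gap a b 0 x
    have h3 : (1 - xbar ^ 2) * (a - 2 * b) ≤ (1 - x ^ 2) * (a * x ^ 2 + a - 2 * b - 2 * 0 ^ 2) :=
      mul_le_mul (by linarith) (by nlinarith [sq_nonneg x]) (by linarith) (by linarith)
    linarith
  have hf : ∀ r, 0 ≤ r → 2 * f r ^ 2 < a * g r ^ 2 + a - 2 * b := by
    intro r hr
    by_contra hc
    push Not at hc
    nlinarith [hgap r hr, hg r hr]
  obtain ⟨hf0, hg0, hcf, hcg, hd⟩ := h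
  refine ⟨hb, hab, hδ, hcf, hcg, fun r hr => (hd r hr.le hr).1, fun r hr => (hd r hr.le hr).2,
    fun r => hφ.1 _ _, fun r hr hgr => hφ.eq_one hη (by linarith [hf r hr]), hg, hgap,
    fun r hr hfr hgr => ?_⟩
  have hzero : ∀ s, 0 < s → s ≤ r → g s = 0 := by
    intro s hs hsr
    have h1 := exp_mul_le_of_hasDerivAt (u := fun r => f r ^ 2 + g r ^ 2)
      (K := -((a + 1) + 4 / s)) hsr
      (((hcf.pow 2).add (hcg.pow 2)).mono (Icc_subset_Ici_self.trans (Ici_subset_Ici.2 hs.le)))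
      (fun q hq => by
        have hq0 : 0 < q := hs.trans hq.1
        obtain ⟨h1, h2⟩ := hd q hq0.le hq0
        refine ⟨_, (h1.pow 2).add (h2.pow 2), ?_⟩
        have h3 := hf q hq0.le
        have h4 := hg q hq0.le
        have h5 := hφ.1 (f q) (g q)
        have h6 : 4 * φ (f q) (g q) / q * f q ^ 2 ≤ 4 * 1 / s * f q ^ 2 := by
          gcongr
          · exact h5.2
          · exact hq.1.le
        have h7 : 4 / s * (f q ^ 2 + g q ^ 2) = 4 * 1 / s * f q ^ 2 + 4 / s * g q ^ 2 := by ring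
        have h8 : 0 ≤ 4 / s * g q ^ 2 := by positivity
        set P := f q ^ 2 - a * g q ^ 2 + b + 1 - g q ^ 2 with hP
        have h9 : |P| ≤ a + 1 := by
          rw [abs_le]
          constructor <;> nlinarith [sq_nonneg (f q), sq_nonneg (g q)]
        have h10 : |2 * f q * g q * P| ≤ (f q ^ 2 + g q ^ 2) * (a + 1) := by
          rw [abs_mul]
          refine mul_le_mul ?_ h9 (abs_nonneg _) (by positivity)
          rw [abs_le]
          constructor <;> nlinarith [sq_nonneg (f q + g q), sq_nonneg (f q - g q)]
        have h11 := (abs_le.1 h10).1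
        push_cast
        rw [hP] at h11
        have h12 : 2 * f q * (2 * φ (f q) (g q) / q * f q) = 4 * φ (f q) (g q) / q * f q ^ 2 := by
          ring
        linarith)
    simp only [hfr, hgr] at h1
    have h2 := exp_pos (-((a + 1) + 4 / s) * (r - s))
    have h3 : f s ^ 2 + g s ^ 2 ≤ 0 := by
      by_contra hc
      push Not at hc
      have := mul_pos h2 hc
      linarith
    nlinarith [sq_nonneg (f s), sq_nonneg (g s)]
  obtain ⟨s, hs, hgs⟩ := intermediate_value_Icc' hr (hcg.mono Icc_subset_Ici_self)
    (⟨by rw [hgr]; positivity, by rw [hg0]; linarith⟩ : x / 2 ∈ Icc (g r) (g 0))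
  have hs0 : s ≠ 0 := fun h => by rw [h, hg0] at hgs; linarith
  rw [hzero s (lt_of_le_of_ne hs.1 hs0.symm) hs.2] at hgs
  linarith

end IsRegSolOn

theorem exists_abs_sub_le_of_contDiffOn {ψ : ℝ × ℝ → ℝ} {m : ℝ}
    (hψ : ContDiffOn ℝ (⊤ : ℕ∞) ψ (Icc (-m) m ×ˢ Icc (-1 : ℝ) 1)) :
    ∃ L : ℝ, 0 ≤ L ∧ ∀ f₁ f₂ g₁ g₂ : ℝ, |f₁| ≤ m → |f₂| ≤ m → |g₁| ≤ 1 → |g₂| ≤ 1 →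
      ∀ e, |f₂ - f₁| ≤ e → |g₂ - g₁| ≤ e → |ψ (f₂, g₂) - ψ (f₁, g₁)| ≤ L * e := by
  obtain ⟨K, hK⟩ := hψ.exists_lipschitzOnWith (by simp) ((convex_Icc _ _).prod (convex_Icc _ _))
    (isCompact_Icc.prod isCompact_Icc)
  refine ⟨K, K.2, fun f₁ f₂ g₁ g₂ hf₁ hf₂ hg₁ hg₂ e hf hg => ?_⟩
  have h1 := hK.dist_le_mul (f₂, g₂) ⟨abs_le.1 hf₂, abs_le.1 hg₂⟩ (f₁, g₁)
    ⟨abs_le.1 hf₁, abs_le.1 hg₁⟩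
  rw [Real.dist_eq, Prod.dist_eq] at h1
  exact h1.trans (mul_le_mul_of_nonneg_left (max_le hf hg) K.2)

theorem IsDampedOrbit.f_sq_le {a b δ : ℝ} {f g d : ℝ → ℝ} (h : IsDampedOrbit a b δ f g d) {r : ℝ}
    (hr : 0 ≤ r) : f r ^ 2 ≤ a - b - 2 * δ := by
  have h1 := h.gap r hr
  have h2 := h.g_lt r hr
  have h3 := h.f_sq_lt hr
  have h4 := h.a_pos
  nlinarith [mul_nonneg (sq_nonneg (g r)) (sub_nonneg.2 h3.le)]

/-- The cutoff is inactive near the origin, uniformly in the orbit. -/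
theorem IsDampedOrbit.f_sq_le_mul {a b δ : ℝ} {f g d : ℝ → ℝ} (h : IsDampedOrbit a b δ f g d)
    (hf0 : f 0 = 0) {r : ℝ} (hr : 0 ≤ r) : f r ^ 2 ≤ 2 * √(a - b) * a * r := by
  have h1 := le_of_hasDerivAt_nonneg (u := fun r => 2 * √(a - b) * a * r - f r ^ 2) hr
    ((continuousOn_const.mul continuousOn_id).sub ((h.cont_f_Icc le_rfl).pow 2)) (fun q hq => by
      refine ⟨_, ((hasDerivAt_id q).const_mul _).sub ((h.derivf q hq.1).pow 2), ?_⟩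
      have h2 := h.f_sq_lt hq.1.le
      have h3 := h.g_lt q hq.1.le
      have h4 := h.a_pos
      have h5 := h.hb
      have h6 := h.hab
      have h7 : |f q ^ 2 - a * g q ^ 2 + b| ≤ a := by
        rw [abs_le]
        constructor <;> nlinarith [sq_nonneg (f q), sq_nonneg (g q)]
      have h8 : |f q * g q * (f q ^ 2 - a * g q ^ 2 + b)| ≤ √(a - b) * 1 * a := by
        rw [abs_mul, abs_mul]
        exact mul_le_mul (mul_le_mul (h.abs_f_lt hq.1.le).le (h.abs_g_lt hq.1.le).le
          (abs_nonneg _) (Real.sqrt_nonneg _)) h7 (abs_nonneg _) (by positivity)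
      have h9 := (abs_le.1 h8).2
      have h10 : 0 ≤ 2 * d q / q * f q ^ 2 := by
        have := (h.damp_mem q).1
        have := hq.1
        positivity
      push_cast
      nlinarith)
  simp only [hf0] at h1
  linarith

/-- Lipschitz dependence of regularized orbits on the shooting parameter. -/
theorem exists_dist_sq_le {a b η xbar : ℝ} {φ : ℝ → ℝ → ℝ} (hb : 0 < b)
    (hab : 2 * b < a) (hη : η ∈ Ioo 0 (√(a - b) - √(a / 2))) (hφ : IsCutoff a b η φ)
    (hx1 : xbar < 1) :
    ∃ C : ℝ, ∀ x y, 0 < x → x ≤ xbar → 0 < y → y ≤ xbar → ∀ f g u v : ℝ → ℝ,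
      IsRegSolOn a b φ x f g (Ici 0) → IsRegSolOn a b φ y u v (Ici 0) → ∀ r, 0 ≤ r →
        (u r - f r) ^ 2 + (v r - g r) ^ 2 ≤ exp (C * r) * (y - x) ^ 2 := by
  by_cases hx0 : 0 < xbar
  swap
  · exact ⟨0, fun x y hx hxx => absurd (hx.trans_le hxx) hx0⟩
  have ha : 0 < a := by linarith
  have hδ : 0 < (1 - xbar ^ 2) * (a - 2 * b) / 4 := by
    have : 0 < (1 - xbar ^ 2) * (a - 2 * b) := mul_pos (by nlinarith) (by linarith)
    linarith
  set δ := (1 - xbar ^ 2) * (a - 2 * b) / 4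
  set m := √(a - b - 2 * δ) with hm
  have hmlt : m < √(a - b) := (Real.sqrt_lt_sqrt_iff_of_pos (by linarith)).2 (by linarith)
  obtain ⟨L₁, hL₁, hV⟩ := exists_abs_sub_le_of_contDiffOn (m := m)
    (ψ := fun p => p.2 * (p.1 ^ 2 - a * p.2 ^ 2 + b)) (by fun_prop)
  obtain ⟨L₂, hL₂, hW⟩ := exists_abs_sub_le_of_contDiffOn (m := m)
    (ψ := fun p => p.1 * (1 - p.2 ^ 2)) (by fun_prop)
  obtain ⟨L₃, hL₃, hψ⟩ := exists_abs_sub_le_of_contDiffOn (m := m)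
    (ψ := fun p => φ p.1 p.2 * p.1) (by
      refine (hφ.2.1.mono ?_).mul contDiff_fst.contDiffOn
      exact prod_mono (Icc_subset_Ioo (neg_lt_neg hmlt) hmlt) (subset_univ _))
  obtain ⟨r₀, hr₀, hr₀'⟩ : ∃ r₀ : ℝ, 0 < r₀ ∧ 2 * √(a - b) * a * r₀ ≤ a / 2 := by
    have : 0 < √(a - b) := Real.sqrt_pos.2 (by linarith)
    refine ⟨1 / (4 * √(a - b)), by positivity, ?_⟩
    field_simp
    norm_num
  refine ⟨2 * L₁ + 2 * L₂ + 4 / r₀ * L₃, fun x y hx hxx hy hyx f g u v h₁ h₂ r hr => ?_⟩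
  have o₁ := h₁.isDampedOrbit hb hab hη hφ hx hxx hx1
  have o₂ := h₂.isDampedOrbit hb hab hη hφ hy hyx hx1
  have h1 := le_exp_mul_of_hasDerivAt (u := fun r => (u r - f r) ^ 2 + (v r - g r) ^ 2)
    (K := 2 * L₁ + 2 * L₂ + 4 / r₀ * L₃) hr
    ((((o₂.cont_f_Icc le_rfl).sub (o₁.cont_f_Icc le_rfl)).pow 2).add
      (((o₂.cont_g_Icc le_rfl).sub (o₁.cont_g_Icc le_rfl)).pow 2)) (fun q hq => by
      refine ⟨_, (((o₂.derivf q hq.1).sub (o₁.derivf q hq.1)).pow 2).add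
        (((o₂.derivg q hq.1).sub (o₁.derivg q hq.1)).pow 2), ?_⟩
      have hq0 := hq.1
      obtain ⟨e, he⟩ : ∃ e, e = max |u q - f q| |v q - g q| := ⟨_, rfl⟩
      have he1 : |u q - f q| ≤ e := he ▸ le_max_left _ _
      have he2 : |v q - g q| ≤ e := he ▸ le_max_right _ _
      have he0 : 0 ≤ e := (abs_nonneg _).trans he1
      have hee : e * e ≤ (u q - f q) ^ 2 + (v q - g q) ^ 2 := by
        rw [← sq_abs (u q - f q), ← sq_abs (v q - g q)]
        rcases max_choice |u q - f q| |v q - g q| with h | h <;> rw [he, h] <;>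
          nlinarith [sq_nonneg |u q - f q|, sq_nonneg |v q - g q|]
      have hprod : ∀ s t c : ℝ, 0 ≤ c → |s| ≤ e → |t| ≤ c * e →
          |s * t| ≤ c * ((u q - f q) ^ 2 + (v q - g q) ^ 2) := fun s t c hc hs ht => by
        rw [abs_mul]
        calc |s| * |t| ≤ e * (c * e) := by gcongr
          _ = c * (e * e) := by ring
          _ ≤ _ := by gcongr
      have hf₁ := Real.abs_le_sqrt (o₁.f_sq_le hq0.le)
      have hf₂ := Real.abs_le_sqrt (o₂.f_sq_le hq0.le)
      have hg₁ := (o₁.abs_g_lt hq0.le).le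
      have hg₂ := (o₂.abs_g_lt hq0.le).le
      have h1 := (abs_le.1 (hprod _ _ _ hL₁ he1
        (hV (f q) (u q) (g q) (v q) hf₁ hf₂ hg₁ hg₂ e he1 he2))).2
      have h2 := (abs_le.1 (hprod _ _ _ hL₂ he2
        (hW (f q) (u q) (g q) (v q) hf₁ hf₂ hg₁ hg₂ e he1 he2))).2
      have h3 : -(4 / q * ((u q - f q) * (φ (u q) (v q) * u q - φ (f q) (g q) * f q))) ≤
          4 / r₀ * L₃ * ((u q - f q) ^ 2 + (v q - g q) ^ 2) := by
        have hE : 0 ≤ (u q - f q) ^ 2 + (v q - g q) ^ 2 := by positivity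
        rcases le_total q r₀ with hqr | hqr
        · have hC : 2 * √(a - b) * a * q ≤ a / 2 := le_trans (by gcongr) hr₀'
          rw [hφ.eq_one hη ((o₁.f_sq_le_mul h₁.1 hq0.le).trans hC),
            hφ.eq_one hη ((o₂.f_sq_le_mul h₂.1 hq0.le).trans hC)]
          have h4 : 0 ≤ 4 / q * (u q - f q) ^ 2 := by positivity
          have h5 : 0 ≤ 4 / r₀ * L₃ * ((u q - f q) ^ 2 + (v q - g q) ^ 2) := by positivity
          linarith
        · have h4 := hprod _ _ _ hL₃ he1
            (hψ (f q) (u q) (g q) (v q) hf₁ hf₂ hg₁ hg₂ e he1 he2)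
          calc _ ≤ |-(4 / q * ((u q - f q) * (φ (u q) (v q) * u q - φ (f q) (g q) * f q)))| :=
                le_abs_self _
            _ = 4 / q * |(u q - f q) * (φ (u q) (v q) * u q - φ (f q) (g q) * f q)| := by
                rw [abs_neg, abs_mul, abs_of_pos (by positivity : 0 < 4 / q)]
            _ ≤ 4 / r₀ * (L₃ * ((u q - f q) ^ 2 + (v q - g q) ^ 2)) := by gcongr
            _ = _ := by ring
      push_cast
      simp only [Pi.sub_apply]
      linear_combination 2 * h1 + 2 * h2 + h3)
  simp only [h₁.1, h₁.2.1, h₂.1, h₂.2.1] at h1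
  simpa using h1

theorem mul_pos_of_abs_sub_lt {x y : ℝ} (h : |x - y| < |y|) : 0 < x * y := by
  rw [abs_lt] at h
  rcases le_total 0 y with hy | hy
  · rw [abs_of_nonneg hy] at h
    have : 0 < y := by linarith
    exact mul_pos (by linarith) this
  · rw [abs_of_nonpos hy] at h
    have : y < 0 := by linarith
    exact mul_pos_of_neg_of_neg (by linarith) this

namespace IsDampedOrbit

variable {a b δ : ℝ} {f g d : ℝ → ℝ}

theorem g_lt_of_f_pos (h : IsDampedOrbit a b δ f g d) {s t : ℝ} (hs : 0 ≤ s) (hst : s < t)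
    (hf : ∀ r ∈ Ioo s t, 0 < f r) : g s < g t := by
  obtain ⟨c, hc, hc'⟩ := exists_hasDerivAt_eq_slope g _ hst (h.cont_g_Icc hs)
    (fun r hr => h.derivg r (hs.trans_lt hr.1))
  have h1 : 0 < f c * (1 - g c ^ 2) :=
    mul_pos (hf c hc) (sub_pos.2 (h.g_lt c (hs.trans hc.1.le)))
  rw [hc', div_pos_iff_of_pos_right (sub_pos.2 hst)] at h1
  linarith

theorem g_ne_of_f_ne_zero (h : IsDampedOrbit a b δ f g d) {s t : ℝ} (hs : 0 ≤ s) (hst : s < t)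
    (hf : ∀ r ∈ Ioo s t, f r ≠ 0) : g s ≠ g t := by
  intro heq
  obtain ⟨c, hc, hc'⟩ := exists_hasDerivAt_eq_zero hst (h.cont_g_Icc hs) heq
    (fun r hr => h.derivg r (hs.trans_lt hr.1))
  exact hf c hc ((mul_eq_zero.1 hc').resolve_right
    (sub_pos.2 (h.g_lt c (hs.trans hc.1.le))).ne')

theorem g_mul_g_neg (h : IsDampedOrbit a b δ f g d) {s t z : ℝ} (hs : 0 ≤ s) (hsz : s < z)
    (hzt : z < t) (hf : ∀ r ∈ Icc s t, f r ≠ 0) (hg : g z = 0) : g s * g t < 0 := by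
  wlog hfz : 0 < f z generalizing f g
  · have hfz' : 0 < -f z := by
      have := lt_of_le_of_ne (not_lt.1 hfz) (hf z ⟨hsz.le, hzt.le⟩)
      linarith
    have := this h.neg (fun r hr => neg_ne_zero.2 (hf r hr)) (by rw [hg, neg_zero]) hfz'
    rwa [neg_mul_neg] at this
  have hpos := pos_of_ne_zero_on_Icc (h.cont_f_Icc hs) hf ⟨hsz.le, hzt.le⟩ hfz
  have h1 := h.g_lt_of_f_pos hs hsz fun r hr => hpos r ⟨hr.1.le, hr.2.le.trans hzt.le⟩
  have h2 := h.g_lt_of_f_pos (hs.trans hsz.le) hzt fun r hr =>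
    hpos r ⟨hsz.le.trans hr.1.le, hr.2.le⟩
  rw [hg] at h1 h2
  exact mul_neg_of_neg_of_pos h1 h2

/-- The number of zeros of `g` on a bounded interval is stable under uniform perturbations. -/
theorem exists_ncard_zeros_eq (h : IsDampedOrbit a b δ f g d) (hg0 : g 0 ≠ 0) {R : ℝ}
    (hgR : g R ≠ 0) :
    ∃ ε, 0 < ε ∧ ∀ u v d' : ℝ → ℝ, IsDampedOrbit a b δ u v d' →
      (∀ r ∈ Icc 0 R, |u r - f r| < ε ∧ |v r - g r| < ε) →
      {r | r ∈ Ioo 0 R ∧ v r = 0}.ncard = {r | r ∈ Ioo 0 R ∧ g r = 0}.ncard := by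
  set Z := {r | r ∈ Ioo 0 R ∧ g r = 0} with hZ
  have hfin : Z.Finite := (h.finite_zeros hg0).subset fun r hr => ⟨hr.1.1, hr.2⟩
  have hev : ∀ z ∈ Z, ∀ᶠ ρ : ℝ in 𝓝[>] 0, ∀ r, |r - z| ≤ ρ → r ∈ Ioo 0 R ∧ ρ < |f r| := by
    intro z hz
    have hfz : 0 < |f z| := abs_pos.2 fun h0 => h.ne_zero z hz.1.1.le h0 hz.2
    have h1 : ∀ᶠ r in 𝓝 z, r ∈ Ioo 0 R ∧ |f z| / 2 < |f r| :=
      (show ∀ᶠ r in 𝓝 z, r ∈ Ioo 0 R from Ioo_mem_nhds hz.1.1 hz.1.2).and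
        ((h.derivf z hz.1.1).continuousAt.abs.eventually_const_lt (half_lt_self hfz))
    obtain ⟨e, he, h2⟩ := Metric.eventually_nhds_iff.1 h1
    filter_upwards [Ioo_mem_nhdsGT (lt_min he (half_pos hfz))] with ρ hρ r hr
    have h3 := h2 (y := r) (by
      rw [Real.dist_eq]; exact hr.trans_lt (hρ.2.trans_le (min_le_left _ _)))
    exact ⟨h3.1, (hρ.2.trans_le (min_le_right _ _)).trans h3.2⟩
  obtain ⟨ρ, hρ, hρ0⟩ := (((eventually_all_finite hfin).2 hev).and self_mem_nhdsWithin).exists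
  have hρ0 : 0 < ρ := hρ0
  have hK : IsCompact (Icc 0 R ∩ {r | ∀ z ∈ Z, ρ ≤ |r - z|}) := by
    refine isCompact_Icc.inter_right ?_
    simp only [ofPred_forall]
    exact isClosed_biInter fun z _ => isClosed_le continuous_const (by fun_prop)
  obtain ⟨μ, hμ, hμK⟩ := hK.exists_forall_le' (a := 0)
    ((h.cont_g_Icc le_rfl).abs.mono inter_subset_left) (by
      rintro r ⟨hr, hrZ⟩
      refine abs_pos.2 fun h0 => ?_
      have h1 : r ∈ Z := ⟨⟨lt_of_le_of_ne hr.1 fun h' => hg0 (h' ▸ h0),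
        lt_of_le_of_ne hr.2 fun h' => hgR (h' ▸ h0)⟩, h0⟩
      have := hrZ r h1
      rw [sub_self, abs_zero] at this
      linarith)
  have hsep : ∀ z ∈ Z, ∀ w ∈ Z, z < w → 2 * ρ < w - z := by
    intro z hz w hw hzw
    by_contra hcon
    push Not at hcon
    refine h.g_ne_of_f_ne_zero hz.1.1.le hzw (fun r hr h0 => ?_) (hz.2.trans hw.2.symm)
    have : ρ < |f r| := by
      rcases le_total (r - z) ρ with h1 | h1
      · exact (hρ z hz r (by rw [abs_of_pos (sub_pos.2 hr.1)]; exact h1)).2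
      · refine (hρ w hw r ?_).2
        rw [abs_of_neg (sub_neg.2 hr.2)]
        linarith
    rw [h0, abs_zero] at this
    linarith
  refine ⟨min μ ρ, lt_min hμ hρ0, fun u v d' h' hclose => ?_⟩
  have hmem : ∀ z ∈ Z, ∀ r, |r - z| ≤ ρ → r ∈ Icc 0 R ∧ f r ≠ 0 ∧ u r ≠ 0 := by
    intro z hz r hr
    obtain ⟨h1, h2⟩ := hρ z hz r hr
    have h3 := (hclose r (Ioo_subset_Icc_self h1)).1.trans_le (min_le_right _ _)
    exact ⟨Ioo_subset_Icc_self h1, abs_pos.1 (hρ0.trans h2),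
      left_ne_zero_of_mul (mul_pos_of_abs_sub_lt (h3.trans h2)).ne'⟩
  have hsign : ∀ r ∈ Icc 0 R, (∀ z ∈ Z, ρ ≤ |r - z|) → 0 < v r * g r := fun r hr hrZ =>
    mul_pos_of_abs_sub_lt (((hclose r hr).2.trans_le (min_le_left _ _)).trans_le
      (hμK r ⟨hr, hrZ⟩))
  have hend : ∀ z ∈ Z, ∀ w ∈ Z, ρ ≤ |z - ρ - w| ∧ ρ ≤ |z + ρ - w| := by
    intro z hz w hw
    rcases lt_trichotomy z w with hzw | rfl | hzw
    · have := hsep z hz w hw hzw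
      constructor <;> rw [le_abs] <;> right <;> linarith
    · constructor <;> rw [le_abs]
      · right; linarith
      · left; linarith
    · have := hsep w hw z hz hzw
      constructor <;> rw [le_abs] <;> left <;> linarith
  have hnear : ∀ z r, r ∈ Icc (z - ρ) (z + ρ) → |r - z| ≤ ρ := fun z r hr =>
    abs_le.2 ⟨by linarith [hr.1], by linarith [hr.2]⟩
  have hex : ∀ z ∈ Z, ∃ w ∈ Ioo (z - ρ) (z + ρ), v w = 0 := by
    intro z hz
    by_contra hcon
    push Not at hcon
    have hl := (hmem z hz (z - ρ) (hnear z _ ⟨le_rfl, by linarith⟩)).1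
    have hr := (hmem z hz (z + ρ) (hnear z _ ⟨by linarith, le_rfl⟩)).1
    have h1 := hsign _ hl fun w hw => (hend z hz w hw).1
    have h2 := hsign _ hr fun w hw => (hend z hz w hw).2
    have h3 := h.g_mul_g_neg hl.1 (by linarith : z - ρ < z) (by linarith : z < z + ρ)
      (fun r hr => (hmem z hz r (hnear z r hr)).2.1) hz.2
    have h4 : 0 ≤ v (z - ρ) * v (z + ρ) := by
      rcases nonneg_or_nonpos_of_ne_zero (h'.cont_g_Icc hl.1) hcon with h5 | h5
      · exact mul_nonneg (h5 _ ⟨le_rfl, by linarith⟩) (h5 _ ⟨by linarith, le_rfl⟩)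
      · exact mul_nonneg_of_nonpos_of_nonpos (h5 _ ⟨le_rfl, by linarith⟩)
          (h5 _ ⟨by linarith, le_rfl⟩)
    have h5 := mul_pos h1 h2
    have h6 := mul_nonpos_of_nonneg_of_nonpos h4 h3.le
    linarith
  have huniq : ∀ z ∈ Z, ∀ w₁ ∈ Ioo (z - ρ) (z + ρ), ∀ w₂ ∈ Ioo (z - ρ) (z + ρ),
      v w₁ = 0 → v w₂ = 0 → ¬ w₁ < w₂ := by
    intro z hz w₁ hw₁ w₂ hw₂ h1 h2 hlt
    refine h'.g_ne_of_f_ne_zero (hmem z hz w₁ (hnear z _ (Ioo_subset_Icc_self hw₁))).1.1 hlt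
      (fun r hr => ?_) (h1.trans h2.symm)
    exact (hmem z hz r (hnear z r ⟨hw₁.1.le.trans hr.1.le, hr.2.le.trans hw₂.2.le⟩)).2.2
  choose! e he hve using hex
  refine (Set.ncard_congr (fun z _ => e z) (fun z hz => ?_) (fun z w hz hw hzw => ?_)
    fun w hw => ?_).symm
  · exact ⟨(hρ z hz (e z) (hnear z _ (Ioo_subset_Icc_self (he z hz)))).1, hve z hz⟩
  · have h1 := he z hz
    have h2 := he w hw
    rw [← hzw] at h2
    by_contra hne
    rcases lt_or_gt_of_ne hne with hlt | hlt
    · linarith [hsep z hz w hw hlt, h1.1, h1.2, h2.1, h2.2]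
    · linarith [hsep w hw z hz hlt, h1.1, h1.2, h2.1, h2.2]
  · obtain ⟨z, hz, hzw⟩ : ∃ z ∈ Z, |w - z| < ρ := by
      by_contra hcon
      push Not at hcon
      have := hsign w (Ioo_subset_Icc_self hw.1) hcon
      rw [hw.2, zero_mul] at this
      exact this.false
    rw [abs_lt] at hzw
    have hw' : w ∈ Ioo (z - ρ) (z + ρ) := ⟨by linarith, by linarith⟩
    exact ⟨z, hz, le_antisymm (not_lt.1 (huniq z hz w hw' (e z) (he z hz) hw.2 (hve z hz)))
      (not_lt.1 (huniq z hz (e z) (he z hz) w hw' (hve z hz) hw.2))⟩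

end IsDampedOrbit

/-- The number of positive zeros of `g`. -/
def zeroCount (g : ℝ → ℝ) : ℕ := {r | 0 < r ∧ g r = 0}.ncard

theorem zeroCount_eq_of_forall_ne {g : ℝ → ℝ} {R : ℝ} (hne : ∀ r, R ≤ r → g r ≠ 0) :
    zeroCount g = {r | r ∈ Ioo 0 R ∧ g r = 0}.ncard := by
  unfold zeroCount
  congr 1
  ext r
  exact ⟨fun hr => ⟨⟨hr.1, not_le.1 fun hc => hne r hc hr.2⟩, hr.2⟩, fun hr => ⟨hr.1.1, hr.2⟩⟩

namespace IsDampedOrbit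

variable {a b δ : ℝ} {f g d : ℝ → ℝ}

theorem zeroCount_bounds (h : IsDampedOrbit a b δ f g d) (h0 : g 0 ≠ 0) {R : ℝ} (hR : 0 < R)
    (huniq : ∀ s t, R ≤ s → s < t → g s = 0 → g t ≠ 0) :
    {r | r ∈ Ioo 0 R ∧ g r = 0}.ncard ≤ zeroCount g ∧
      zeroCount g ≤ {r | r ∈ Ioo 0 R ∧ g r = 0}.ncard + 1 := by
  have hfin := h.finite_zeros h0
  have hsplit : {r | 0 < r ∧ g r = 0} = {r | r ∈ Ioo 0 R ∧ g r = 0} ∪ {r | R ≤ r ∧ g r = 0} := by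
    ext r
    constructor
    · rintro ⟨hr, hg⟩
      rcases lt_or_ge r R with hc | hc
      · exact Or.inl ⟨⟨hr, hc⟩, hg⟩
      · exact Or.inr ⟨hc, hg⟩
    · rintro (⟨hr, hg⟩ | ⟨hr, hg⟩)
      · exact ⟨hr.1, hg⟩
      · exact ⟨hR.trans_le hr, hg⟩
  have hone : {r | R ≤ r ∧ g r = 0}.ncard ≤ 1 := by
    refine (Set.ncard_le_one (hfin.subset fun r hr => ⟨hR.trans_le hr.1, hr.2⟩)).2 ?_
    intro s hs t ht
    exact le_antisymm (not_lt.1 fun hc => huniq t s ht.1 hc ht.2 hs.2)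
      (not_lt.1 fun hc => huniq s t hs.1 hc hs.2 ht.2)
  refine ⟨Set.ncard_le_ncard (fun r hr => ⟨hr.1.1, hr.2⟩) hfin, ?_⟩
  unfold zeroCount
  rw [hsplit]
  exact (Set.ncard_union_le _ _).trans (by gcongr)

end IsDampedOrbit

section Family

variable {a b η x : ℝ} {φ F G : ℝ → ℝ → ℝ}

theorem eventually_orbit_close (hb : 0 < b) (hab : 2 * b < a)
    (hη : η ∈ Ioo 0 (√(a - b) - √(a / 2))) (hφ : IsCutoff a b η φ)
    (hFG : ∀ y ∈ Ioo (0 : ℝ) 1, IsRegSolOn a b φ y (F y) (G y) (Ici 0)) (hx : x ∈ Ioo (0 : ℝ) 1)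
    (R : ℝ) {ε : ℝ} (hε : 0 < ε) :
    ∀ᶠ y in 𝓝 x, ∀ r ∈ Icc 0 R, |F y r - F x r| < ε ∧ |G y r - G x r| < ε := by
  have hx1 : (1 + x) / 2 < 1 := by linarith [hx.2]
  obtain ⟨C, hC⟩ := exists_dist_sq_le hb hab hη hφ hx1
  have h1 : ∀ᶠ y in 𝓝 x, exp (|C| * R) * (y - x) ^ 2 < ε ^ 2 := by
    have h2 : ContinuousAt (fun y => exp (|C| * R) * (y - x) ^ 2) x := by fun_prop
    exact h2.eventually_lt_const (by simpa using pow_pos hε 2)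
  have h2 : ∀ᶠ y in 𝓝 x, y ∈ Ioo 0 ((1 + x) / 2) :=
    Ioo_mem_nhds hx.1 (by linarith [hx.2])
  filter_upwards [h1, h2] with y hy hy2 r hr
  have h3 := hC x y hx.1 (by linarith [hx.2]) hy2.1 hy2.2.le _ _ _ _ (hFG x hx)
    (hFG y ⟨hy2.1, hy2.2.trans hx1⟩) r hr.1
  have h4 : exp (C * r) * (y - x) ^ 2 ≤ exp (|C| * R) * (y - x) ^ 2 := by
    have : C * r ≤ |C| * R :=
      (mul_le_mul_of_nonneg_right (le_abs_self C) hr.1).trans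
        (mul_le_mul_of_nonneg_left hr.2 (abs_nonneg C))
    gcongr
  constructor <;> refine abs_lt_of_sq_lt_sq ?_ hε.le <;> nlinarith

theorem eventually_ham_lt (hb : 0 < b) (hab : 2 * b < a)
    (hη : η ∈ Ioo 0 (√(a - b) - √(a / 2))) (hφ : IsCutoff a b η φ)
    (hFG : ∀ y ∈ Ioo (0 : ℝ) 1, IsRegSolOn a b φ y (F y) (G y) (Ici 0)) (hx : x ∈ Ioo (0 : ℝ) 1)
    {R c : ℝ} (hR : 0 ≤ R) (hc : Ham a b (F x R) (G x R) < c) :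
    ∀ᶠ y in 𝓝 x, Ham a b (F y R) (G y R) < c := by
  have hclose := fun ε (hε : 0 < ε) => (eventually_orbit_close hb hab hη hφ hFG hx R hε).mono
    fun y hy => hy R ⟨hR, le_rfl⟩
  have h1 : Tendsto (fun y => F y R) (𝓝 x) (𝓝 (F x R)) :=
    Metric.tendsto_nhds.2 fun ε hε => (hclose ε hε).mono fun y hy => hy.1
  have h2 : Tendsto (fun y => G y R) (𝓝 x) (𝓝 (G x R)) :=
    Metric.tendsto_nhds.2 fun ε hε => (hclose ε hε).mono fun y hy => hy.2
  exact (((continuous_ham a b).tendsto _).comp (h1.prodMk_nhds h2)).eventually_lt_const hc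

/-- Nearby initial values give damped orbits with common constants and equally many zeros
on a given bounded interval. -/
theorem eventually_isDampedOrbit (hb : 0 < b) (hab : 2 * b < a)
    (hη : η ∈ Ioo 0 (√(a - b) - √(a / 2))) (hφ : IsCutoff a b η φ)
    (hFG : ∀ y ∈ Ioo (0 : ℝ) 1, IsRegSolOn a b φ y (F y) (G y) (Ici 0)) (hx : x ∈ Ioo (0 : ℝ) 1)
    {R : ℝ} (hgR : G x R ≠ 0) :
    ∀ᶠ y in 𝓝 x, y ∈ Ioo 0 1 ∧
      IsDampedOrbit a b ((1 - ((1 + x) / 2) ^ 2) * (a - 2 * b) / 4) (F y) (G y)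
        (fun r => φ (F y r) (G y r)) ∧
      {r | r ∈ Ioo 0 R ∧ G y r = 0}.ncard = {r | r ∈ Ioo 0 R ∧ G x r = 0}.ncard := by
  have hx1 : (1 + x) / 2 < 1 := by linarith [hx.2]
  have hox := (hFG x hx).isDampedOrbit hb hab hη hφ hx.1 (by linarith [hx.2]) hx1
  obtain ⟨ε, hε, hcount⟩ := hox.exists_ncard_zeros_eq
    (by rw [(hFG x hx).2.1]; exact hx.1.ne') hgR
  have h2 : ∀ᶠ y in 𝓝 x, y ∈ Ioo 0 ((1 + x) / 2) :=
    Ioo_mem_nhds hx.1 (by linarith [hx.2])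
  filter_upwards [eventually_orbit_close hb hab hη hφ hFG hx R hε, h2] with y hy hy2
  have hy1 : y ∈ Ioo (0 : ℝ) 1 := ⟨hy2.1, hy2.2.trans hx1⟩
  have hoy := (hFG y hy1).isDampedOrbit hb hab hη hφ hy2.1 hy2.2.le hx1
  exact ⟨hy1, hoy, hcount _ _ _ hoy hy⟩

theorem eventually_zeroCount_eq (hb : 0 < b) (hab : 2 * b < a)
    (hη : η ∈ Ioo 0 (√(a - b) - √(a / 2))) (hφ : IsCutoff a b η φ)
    (hFG : ∀ y ∈ Ioo (0 : ℝ) 1, IsRegSolOn a b φ y (F y) (G y) (Ici 0)) (hx : x ∈ Ioo (0 : ℝ) 1)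
    {R : ℝ} (hR : 0 ≤ R) (hH : Ham a b (F x R) (G x R) < 0) :
    ∀ᶠ y in 𝓝 x, y ∈ Ioo 0 1 ∧ zeroCount (G y) = zeroCount (G x) := by
  have hgR := ((hFG x hx).isDampedOrbit hb hab hη hφ hx.1 le_rfl hx.2).ne_zero_of_ham_neg hR hH
  have hev := eventually_isDampedOrbit hb hab hη hφ hFG hx hgR
  have key : ∀ {y}, IsDampedOrbit a b ((1 - ((1 + x) / 2) ^ 2) * (a - 2 * b) / 4) (F y) (G y)
        (fun r => φ (F y r) (G y r)) → Ham a b (F y R) (G y R) < 0 →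
      zeroCount (G y) = {r | r ∈ Ioo 0 R ∧ G y r = 0}.ncard := fun ho hneg =>
    zeroCount_eq_of_forall_ne fun r hr => ho.ne_zero_of_ham_neg (hR.trans hr)
      ((ho.ham_anti hR hr).trans_lt hneg)
  have hx' := key hev.self_of_nhds.2.1 hH
  filter_upwards [hev, eventually_ham_lt hb hab hη hφ hFG hx hR hH] with y hy hy2
  exact ⟨hy.1, by rw [key hy.2.1 hy2, hy.2.2, hx']⟩

theorem eventually_zeroCount_bounds (hb : 0 < b) (hab : 2 * b < a)
    (hη : η ∈ Ioo 0 (√(a - b) - √(a / 2))) (hφ : IsCutoff a b η φ)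
    (hFG : ∀ y ∈ Ioo (0 : ℝ) 1, IsRegSolOn a b φ y (F y) (G y) (Ici 0)) (hx : x ∈ Ioo (0 : ℝ) 1)
    (hH : ∀ r, 0 ≤ r → 0 < Ham a b (F x r) (G x r)) :
    ∀ᶠ y in 𝓝 x, y ∈ Ioo 0 1 ∧ zeroCount (G x) ≤ zeroCount (G y) ∧
      zeroCount (G y) ≤ zeroCount (G x) + 1 := by
  have hox := (hFG x hx).isDampedOrbit hb hab hη hφ hx.1
    (by linarith [hx.2] : x ≤ (1 + x) / 2) (by linarith [hx.2])
  obtain ⟨κ, R₁, hκ, hR₁, huniq⟩ := exists_zero_unique_of_ham_lt hb hab hox.hδ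
  obtain ⟨-, -, ⟨R₂, hR₂, hne⟩, hlim⟩ := hox.tendsto_of_ham_pos hH
  obtain ⟨R, hRκ, hRR₁, hRR₂⟩ := ((hlim (κ / 2) (half_pos hκ)).and
    ((eventually_ge_atTop R₁).and (eventually_ge_atTop R₂))).exists
  have hR : 0 < R := hR₁.trans_le hRR₁
  have hHR : Ham a b (F x R) (G x R) < κ / R := by
    rw [lt_div_iff₀ hR]
    linarith
  have hx' := zeroCount_eq_of_forall_ne fun r hr => hne r (hRR₂.trans hr)
  filter_upwards [eventually_isDampedOrbit hb hab hη hφ hFG hx (hne R hRR₂),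
    eventually_ham_lt hb hab hη hφ hFG hx hR.le hHR] with y hy hy2
  refine ⟨hy.1, ?_⟩
  rw [hx', ← hy.2.2]
  exact hy.2.1.zeroCount_bounds (by rw [(hFG y hy.1).2.1]; exact hy.1.1.ne') hR
    (huniq _ _ _ hy.2.1 R hRR₁ hy2)

theorem one_sub_g_sq_le (hb : 0 < b) (hab : 2 * b < a)
    (hη : η ∈ Ioo 0 (√(a - b) - √(a / 2))) (hφ : IsCutoff a b η φ) {f g : ℝ → ℝ}
    (h : IsRegSolOn a b φ x f g (Ici 0)) (hx : x ∈ Ioo (0 : ℝ) 1) {ρ : ℝ} (hρ : 0 ≤ ρ) :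
    1 - g ρ ^ 2 ≤ exp (2 * √(a - b) * ρ) * (1 - x ^ 2) := by
  have ho := h.isDampedOrbit hb hab hη hφ hx.1 le_rfl hx.2
  have := le_exp_mul_of_hasDerivAt (u := fun r => 1 - g r ^ 2) (K := 2 * √(a - b)) hρ
    (continuousOn_const.sub ((ho.cont_g_Icc le_rfl).pow 2)) (by
      intro r hr
      refine ⟨_, ((ho.derivg r hr.1).pow 2).const_sub 1, ?_⟩
      have h1 := ho.abs_f_lt hr.1.le
      have h2 := ho.abs_g_lt hr.1.le
      have h3 := ho.g_lt r hr.1.le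
      have h4 : -(g r * f r) ≤ √(a - b) := by
        refine (neg_le_abs _).trans ?_
        rw [abs_mul]
        nlinarith [abs_nonneg (g r), abs_nonneg (f r)]
      have h5 := mul_le_mul_of_nonneg_right h4 (sub_pos.2 h3).le
      push_cast
      linarith)
  simpa [h.2.1] using this

theorem eventually_lt_zeroCount (hb : 0 < b) (hab : 2 * b < a)
    (hη : η ∈ Ioo 0 (√(a - b) - √(a / 2))) (hφ : IsCutoff a b η φ)
    (hFG : ∀ y ∈ Ioo (0 : ℝ) 1, IsRegSolOn a b φ y (F y) (G y) (Ici 0)) (k : ℕ) :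
    ∀ᶠ x in 𝓝[<] 1, k < zeroCount (G x) := by
  have ha : 0 < a := by linarith
  have hM : 0 < √(a - b) := Real.sqrt_pos.2 (by linarith)
  have hab' : 0 < a - 2 * b := by linarith
  obtain ⟨ρ, hρ, hρk⟩ : ∃ ρ, 0 < ρ ∧ (k + 1) * (4 * √(a - b) / ρ) = (a - 2 * b) / 16 := by
    refine ⟨64 * (k + 1) * √(a - b) / (a - 2 * b), by positivity, ?_⟩
    field_simp
    ring
  have h1 : ∀ᶠ x in 𝓝[<] 1, 2 * a * (exp (2 * √(a - b) * ρ) * (1 - x ^ 2)) < (a - 2 * b) / 2 := by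
    have h2 : ContinuousAt (fun x => 2 * a * (exp (2 * √(a - b) * ρ) * (1 - x ^ 2))) 1 := by
      fun_prop
    exact nhdsWithin_le_nhds (h2.eventually_lt_const (by simpa using hab'))
  filter_upwards [h1, Ioo_mem_nhdsLT (zero_lt_one' ℝ)] with x hx1 hx
  have ho := (hFG x hx).isDampedOrbit hb hab hη hφ hx.1 le_rfl hx.2
  refine ho.lt_ncard_zeros (by rw [(hFG x hx).2.1]; exact hx.1.ne') hρ ?_
  have h2 := one_sub_g_sq_le hb hab hη hφ (hFG x hx) hx hρ.le
  have h3 := four_mul_ham_gap a b (F x ρ) (G x ρ)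
  have h4 := ho.g_lt ρ hρ.le
  have h5 : (1 - G x ρ ^ 2) * (a * G x ρ ^ 2 + a - 2 * b - 2 * F x ρ ^ 2) ≤
      (1 - G x ρ ^ 2) * (2 * a) :=
    mul_le_mul_of_nonneg_left (by nlinarith [sq_nonneg (F x ρ)]) (sub_pos.2 h4).le
  rw [hρk]
  nlinarith

theorem exists_zeroCount_eq_zero (hb : 0 < b) (hab : 2 * b < a)
    (hη : η ∈ Ioo 0 (√(a - b) - √(a / 2))) (hφ : IsCutoff a b η φ)
    (hFG : ∀ y ∈ Ioo (0 : ℝ) 1, IsRegSolOn a b φ y (F y) (G y) (Ici 0)) :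
    ∃ x ∈ Ioo (0 : ℝ) 1, zeroCount (G x) = 0 := by
  have ha : 0 < a := by linarith
  have hx2 : √(b / a) ^ 2 = b / a := Real.sq_sqrt (by positivity)
  have hx : √(b / a) ∈ Ioo (0 : ℝ) 1 := by
    refine ⟨Real.sqrt_pos.2 (by positivity), ?_⟩
    rw [Real.sqrt_lt' one_pos, one_pow, div_lt_one ha]
    linarith
  refine ⟨√(b / a), hx, ?_⟩
  have hsol := hFG _ hx
  have ho := hsol.isDampedOrbit hb hab hη hφ hx.1 le_rfl hx.2
  have hH : Ham a b (F √(b / a) 0) (G √(b / a) 0) < 0 := by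
    have : Ham a b 0 √(b / a) = -(b ^ 2 / (4 * a)) := by
      unfold Ham
      rw [show √(b / a) ^ 4 = (√(b / a) ^ 2) ^ 2 by ring, hx2]
      field_simp
      ring
    rw [hsol.1, hsol.2.1, this]
    have : 0 < b ^ 2 / (4 * a) := by positivity
    linarith
  rw [zeroCount_eq_of_forall_ne fun r hr =>
    ho.ne_zero_of_ham_neg hr ((ho.ham_anti le_rfl hr).trans_lt hH)]
  simp

/-- The supremum of the initial values with at most `k` zeros is an interior point whose orbit
has positive energy and exactly `k` zeros. -/
theorem mem_Iset_of_isLUB (hb : 0 < b) (hab : 2 * b < a)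
    (hη : η ∈ Ioo 0 (√(a - b) - √(a / 2))) (hφ : IsCutoff a b η φ)
    (hFG : ∀ y ∈ Ioo (0 : ℝ) 1, IsRegSolOn a b φ y (F y) (G y) (Ici 0)) {k : ℕ} {s : ℝ}
    (hs : IsLUB {x | x ∈ Ioo (0 : ℝ) 1 ∧ zeroCount (G x) ≤ k} s) :
    s ∈ Ioo (0 : ℝ) 1 ∧ zeroCount (G s) = k ∧ s ∈ Iset a b F G k := by
  obtain ⟨x₀, hx₀, hx₀k⟩ := exists_zeroCount_eq_zero hb hab hη hφ hFG
  have hx₀s := hs.1 (show x₀ ∈ {x | x ∈ Ioo (0 : ℝ) 1 ∧ zeroCount (G x) ≤ k} from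
    ⟨hx₀, by omega⟩)
  have hs0 : 0 < s := hx₀.1.trans_le hx₀s
  have hs1 : s < 1 := by
    obtain ⟨l, hl, hlk⟩ := (mem_nhdsLT_iff_exists_Ioo_subset).1
      (eventually_lt_zeroCount hb hab hη hφ hFG k)
    refine lt_of_le_of_lt (hs.2 fun x hx => ?_) hl
    by_contra hc
    have := hlk ⟨not_le.1 hc, hx.1.2⟩
    exact absurd this (not_lt.2 hx.2)
  have hs01 : s ∈ Ioo (0 : ℝ) 1 := ⟨hs0, hs1⟩
  have hfreq : ∃ᶠ y in 𝓝 s, y ∈ Ioo (0 : ℝ) 1 ∧ zeroCount (G y) ≤ k :=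
    mem_closure_iff_frequently.1 (hs.mem_closure ⟨x₀, hx₀, by omega⟩)
  have hgt : ∀ᶠ y in 𝓝[>] s, y ∈ Ioo (0 : ℝ) 1 → k < zeroCount (G y) := by
    filter_upwards [self_mem_nhdsWithin] with y hy hy1
    by_contra hc
    exact absurd (hs.1 ⟨hy1, not_lt.1 hc⟩) (not_le.2 hy)
  have ho := (hFG s hs01).isDampedOrbit hb hab hη hφ hs0 le_rfl hs1
  have h0 : G s 0 ≠ 0 := by rw [(hFG s hs01).2.1]; exact hs0.ne'
  rcases ho.ham_pos_or_neg with hP | ⟨R, hR, hN⟩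
  · have hev := eventually_zeroCount_bounds hb hab hη hφ hFG hs01 hP
    obtain ⟨y, hy, hyk⟩ := (hfreq.and_eventually hev).exists
    obtain ⟨z, hz, hzk⟩ := (hgt.and (nhdsWithin_le_nhds hev)).exists
    have hz' := hz hzk.1
    have hcount : zeroCount (G s) = k := by omega
    obtain ⟨hf, hg, -⟩ := ho.tendsto_of_ham_pos hP
    refine ⟨hs01, hcount, hs01, hf.prodMk_nhds hg, ?_⟩
    rw [← hcount]
    exact ho.changesSignExactly h0
  · have hev := eventually_zeroCount_eq hb hab hη hφ hFG hs01 hR.le (hN R le_rfl)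
    obtain ⟨y, hy, hyk⟩ := (hfreq.and_eventually hev).exists
    obtain ⟨z, hz, hzk⟩ := (hgt.and (nhdsWithin_le_nhds hev)).exists
    have hz' := hz hzk.1
    omega

end Family

/-- Proposition 2.9: there is an increasing sequence `{x_k} ⊂ (0,1)`
with `x_k ∈ I_k` for every `k`. -/
theorem shooting_sequence (a b η : ℝ) (hb : 0 < b) (hab : 2 * b < a)
    (hη : η ∈ Ioo 0 (Real.sqrt (a - b) - Real.sqrt (a / 2)))
    (φ : ℝ → ℝ → ℝ) (hφ : IsCutoff a b η φ)
    (F G : ℝ → ℝ → ℝ)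
    (hFG : ∀ y ∈ Ioo (0 : ℝ) 1, IsRegSolOn a b φ y (F y) (G y) (Ici 0)) :
    ∃ x : ℕ → ℝ, StrictMono x ∧ (∀ k, x k ∈ Ioo (0 : ℝ) 1) ∧
      ∀ k : ℕ, x k ∈ Iset a b F G k := by
  set S : ℕ → Set ℝ := fun k => {x | x ∈ Ioo (0 : ℝ) 1 ∧ zeroCount (G x) ≤ k}
  obtain ⟨x₀, hx₀, hx₀k⟩ := exists_zeroCount_eq_zero hb hab hη hφ hFG
  have hne : ∀ k, (S k).Nonempty := fun k => ⟨x₀, hx₀, by omega⟩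
  have hbdd : ∀ k, BddAbove (S k) := fun k => ⟨1, fun x hx => hx.1.2.le⟩
  have key := fun k => mem_Iset_of_isLUB hb hab hη hφ hFG (isLUB_csSup (hne k) (hbdd k))
  refine ⟨fun k => sSup (S k), strictMono_nat_of_lt_succ fun k => ?_, fun k => (key k).1,
    fun k => (key k).2.2⟩
  refine lt_of_le_of_ne (csSup_le_csSup (hbdd (k + 1)) (hne k)
    fun x hx => ⟨hx.1, hx.2.trans k.le_succ⟩) fun heq => ?_
  have h1 := (key k).2.1
  have h2 := (key (k + 1)).2.1
  change sSup (S k) = sSup (S (k + 1)) at heq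
  change zeroCount (G (sSup (S k))) = k at h1
  change zeroCount (G (sSup (S (k + 1)))) = k + 1 at h2
  rw [heq] at h1
  omega
end
end

section
/- Let a, b > 0 with a − 2b > 0, let f₀ ∈ (√((a−2b)/2), √(a−b)), and set E_c = H(f₀, √((f₀² + b)/a)). Then there exist two monotone continuous functions G₁ : [E_c, H(0,1)] → [√((f₀² + b)/a), 1] and G₂ : [E_c, H(0,1)] → [√((2/a)(f₀² + b) − 1), √((f₀² + b)/a)] such that, for i = 1, 2 and all E ∈ [E_c, H(0,1)]: H(f₀, G_i(E)) = E; the set {(f₀, g) : (f₀, g) ∈ 𝒜, g ≥ 0, H(f₀, g) = E} equals {(f₀, G₁(E)), (f₀, G₂(E))}; and G₁(E) ≥ G₂(E). -/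
open Real Set Filter Topology

noncomputable section

/-- Completing the square in `g ^ 2`: the energy is quadratic in `g ^ 2` with vertex
`c = (f ^ 2 + b) / a`. -/
lemma Ham_eq_sq_add_vertex {a b f c g : ℝ} (hc : a * c = f ^ 2 + b) :
    Ham a b f g = a / 4 * (g ^ 2 - c) ^ 2 + (f ^ 2 / 2 - a / 4 * c ^ 2) := by
  unfold Ham
  linear_combination (1 / 2 * g ^ 2) * hc

/-- Lemma A.1: the two monotone continuous branch functions `G₁`, `G₂`
parametrizing `{(f₀, g) ∈ 𝒜 : g ≥ 0}` by the energy. -/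
theorem branch_functions (a b f₀ : ℝ) (hb : 0 < b) (hab : 2 * b < a)
    (hf₀ : f₀ ∈ Ioo (Real.sqrt ((a - 2 * b) / 2)) (Real.sqrt (a - b))) :
    ∃ G₁ G₂ : ℝ → ℝ,
      ContinuousOn G₁
        (Icc (Ham a b f₀ (Real.sqrt ((f₀ ^ 2 + b) / a))) (Ham a b 0 1)) ∧
      ContinuousOn G₂
        (Icc (Ham a b f₀ (Real.sqrt ((f₀ ^ 2 + b) / a))) (Ham a b 0 1)) ∧
      (MonotoneOn G₁
          (Icc (Ham a b f₀ (Real.sqrt ((f₀ ^ 2 + b) / a))) (Ham a b 0 1)) ∨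
        AntitoneOn G₁
          (Icc (Ham a b f₀ (Real.sqrt ((f₀ ^ 2 + b) / a))) (Ham a b 0 1))) ∧
      (MonotoneOn G₂
          (Icc (Ham a b f₀ (Real.sqrt ((f₀ ^ 2 + b) / a))) (Ham a b 0 1)) ∨
        AntitoneOn G₂
          (Icc (Ham a b f₀ (Real.sqrt ((f₀ ^ 2 + b) / a))) (Ham a b 0 1))) ∧
      ∀ E ∈ Icc (Ham a b f₀ (Real.sqrt ((f₀ ^ 2 + b) / a))) (Ham a b 0 1),
        G₁ E ∈ Icc (Real.sqrt ((f₀ ^ 2 + b) / a)) 1 ∧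
        G₂ E ∈ Icc (Real.sqrt (2 / a * (f₀ ^ 2 + b) - 1)) (Real.sqrt ((f₀ ^ 2 + b) / a)) ∧
        Ham a b f₀ (G₁ E) = E ∧ Ham a b f₀ (G₂ E) = E ∧
        {g : ℝ | (f₀, g) ∈ Aadm a b ∧ 0 ≤ g ∧ Ham a b f₀ g = E} = {G₁ E, G₂ E} ∧
        G₂ E ≤ G₁ E := by
  have ha : 0 < a := by linarith
  obtain ⟨hf_lo, hf_hi⟩ := hf₀
  have hf_pos : 0 < f₀ := (Real.sqrt_nonneg _).trans_lt hf_lo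
  have hf_sq_lo : (a - 2 * b) / 2 < f₀ ^ 2 := (Real.sqrt_lt' hf_pos).1 hf_lo
  have hf_sq_hi : f₀ ^ 2 < a - b := (Real.lt_sqrt hf_pos.le).1 hf_hi
  obtain ⟨c, hc⟩ : ∃ c, c = (f₀ ^ 2 + b) / a := ⟨_, rfl⟩
  have hac : a * c = f₀ ^ 2 + b := by rw [hc]; field_simp
  have hc_lo : 1 / 2 < c := by rw [hc, lt_div_iff₀ ha]; linarith
  have hc_hi : c < 1 := by rw [hc, div_lt_one ha]; linarith
  have hlow : 2 / a * (f₀ ^ 2 + b) - 1 = 2 * c - 1 := by rw [hc]; ring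
  rw [← hc, hlow]
  set m : ℝ := f₀ ^ 2 / 2 - a / 4 * c ^ 2 with hm
  have hvertex : Ham a b f₀ (√c) = m := by
    rw [Ham_eq_sq_add_vertex hac, Real.sq_sqrt (by linarith)]; ring
  have htop : Ham a b 0 1 = a / 4 * (1 - c) ^ 2 + m := by
    rw [hm]; unfold Ham; linear_combination (1 / 2) * hac
  rw [hvertex, htop]
  let s : ℝ → ℝ := fun E => √(4 / a * (E - m))
  have hs_cont : Continuous s := by fun_prop
  have hs_mono : Monotone s := fun x y hxy => by
    dsimp only [s]
    gcongr
  refine ⟨fun E => √(c + s E), fun E => √(c - s E), by fun_prop, by fun_prop,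
    Or.inl fun x _ y _ hxy => Real.sqrt_le_sqrt (by linarith [hs_mono hxy]),
    Or.inr fun x _ y _ hxy => Real.sqrt_le_sqrt (by linarith [hs_mono hxy]), ?_⟩
  rintro E ⟨hE_lo, hE_hi⟩
  dsimp only
  have hs_nonneg : 0 ≤ s E := Real.sqrt_nonneg _
  have hs_sq : s E ^ 2 = 4 / a * (E - m) :=
    Real.sq_sqrt (mul_nonneg (by positivity) (by linarith))
  have hs_sq' : a / 4 * s E ^ 2 = E - m := by rw [hs_sq]; field_simp
  have hs_le : s E ≤ 1 - c := by
    refine (sq_le_sq₀ hs_nonneg (by linarith)).1 ?_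
    refine le_of_mul_le_mul_left (a := a / 4) ?_ (by positivity)
    linarith
  generalize s E = t at *
  have hsq₁ : √(c + t) ^ 2 = c + t := Real.sq_sqrt (by linarith)
  have hsq₂ : √(c - t) ^ 2 = c - t := Real.sq_sqrt (by linarith)
  have hH₁ : Ham a b f₀ (√(c + t)) = E := by
    rw [Ham_eq_sq_add_vertex hac, hsq₁]; linear_combination hs_sq'
  have hH₂ : Ham a b f₀ (√(c - t)) = E := by
    rw [Ham_eq_sq_add_vertex hac, hsq₂]; linear_combination hs_sq'
  have hadm : ∀ g : ℝ, 2 * c - 1 ≤ g ^ 2 → g ^ 2 ≤ 1 → (f₀, g) ∈ Aadm a b := by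
    intro g hg_lo hg_hi
    refine ⟨?_, hg_hi⟩
    dsimp only
    linarith [mul_le_mul_of_nonneg_left hg_lo ha.le]
  refine ⟨⟨Real.sqrt_le_sqrt (by linarith), Real.sqrt_le_one.2 (by linarith)⟩,
    ⟨Real.sqrt_le_sqrt (by linarith), Real.sqrt_le_sqrt (by linarith)⟩, hH₁, hH₂, ?_,
    Real.sqrt_le_sqrt (by linarith)⟩
  ext g
  simp only [mem_ofPred_eq, mem_insert_iff, mem_singleton_iff]
  constructor
  · rintro ⟨-, hg, hgE⟩
    rw [Ham_eq_sq_add_vertex hac] at hgE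
    have hsq : (g ^ 2 - c) ^ 2 = t ^ 2 :=
      mul_left_cancel₀ (by positivity : a / 4 ≠ 0) (by linarith)
    rcases sq_eq_sq_iff_eq_or_eq_neg.1 hsq with h | h
    · left
      rw [← h, add_sub_cancel, Real.sqrt_sq hg]
    · right
      rw [sub_eq_add_neg, ← h, add_sub_cancel, Real.sqrt_sq hg]
  · rintro (rfl | rfl)
    · exact ⟨hadm _ (by linarith) (by linarith), Real.sqrt_nonneg _, hH₁⟩
    · exact ⟨hadm _ (by linarith) (by linarith), Real.sqrt_nonneg _, hH₂⟩
end
end
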